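/- arXiv:0810.0392 — 2 statements merged into one kernel-verified Lean document; each statement's English description precedes it below -/
import Mathlib

section
/- Suppose β ∈ [0,1] and p > 1/2. Then for every initial configuration S₀ ∈ 𝒟, the relaxation time of the discrete-time exclusion-voter chain satisfies E_{β,p}[τ^{6/5} | ξ₀ = S₀] < ∞. -/
open MeasureTheory Filter
open scoped ENNReal NNReal

namespace EV

/-- A configuration of the exclusion-voter model is the finite hybrid-zone word
(`false` = 0, `true` = 1); the full two-sided configuration is `1^∞ w 0^∞`. -/
abbrev Word := List Bool

/-- Canonical (normalized) words: empty (the ground state `𝒟₀`) or starting with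
a `0` and ending with a `1`; these are in bijection with the configuration space `𝒟`. -/
def IsConfig (w : Word) : Prop :=
  w = [] ∨ (w.head? = some false ∧ w.getLast? = some true)

/-- The ground-state Heaviside configuration `𝒟₀ = …111000…`. -/
def groundState : Word := []

/-- Pad a word with one boundary symbol of the adjacent infinite block on each side. -/
def pad (w : Word) : Word := true :: (w ++ [false])

/-- Normalize: strip leading `1`s (they merge into the left infinite block of `1`s)
and trailing `0`s (they merge into the right infinite block of `0`s). -/
def strip (w : Word) : Word :=
  ((w.dropWhile (· = true)).reverse.dropWhile (· = false)).reverse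

def setPair (w : Word) (i : ℕ) (a b : Bool) : Word := (w.set i a).set (i + 1) b

def swapPair (w : Word) (i : ℕ) : Word :=
  setPair w i (w.getD (i + 1) true) (w.getD i true)

/-- Indices of the unlike adjacent pairs (`01` or `10`), read off the padded word. -/
def unlike (w : Word) : List ℕ :=
  (List.range (w.length + 1)).filter
    (fun i => (pad w).getD i true ≠ (pad w).getD (i + 1) true)

/-- One-step transition kernel of the discrete-time exclusion-voter chain with mixing
parameter `β` and exclusion parameter `p`: an unlike adjacent pair is chosen uniformly
at random; with probability `β` a voter move flips the pair to `00` or `11` (each with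
probability `1/2`); with probability `1-β` an exclusion move swaps a `01` with
probability `p` and a `10` with probability `1-p` (otherwise no change). -/
noncomputable def P (β p : ℝ) (w w' : Word) : ℝ :=
  ((unlike w).map (fun i =>
    let a := (pad w).getD i true
    let swapProb := if a then 1 - p else p
    ((unlike w).length : ℝ)⁻¹ *
      (β * (1 / 2) * (if strip (setPair (pad w) i false false) = w' then 1 else 0)
       + β * (1 / 2) * (if strip (setPair (pad w) i true true) = w' then 1 else 0)
       + (1 - β) * swapProb * (if strip (swapPair (pad w) i) = w' then 1 else 0)
       + (1 - β) * (1 - swapProb) * (if w = w' then 1 else 0)))).sum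

/-- `n`-step transition probabilities. -/
noncomputable def Pn (β p : ℝ) : ℕ → Word → Word → ℝ
  | 0 => fun w w' => if w = w' then 1 else 0
  | n + 1 => fun w w' => ∑' z : Word, Pn β p n w z * P β p z w'

/-- `w'` is accessible from `w`: some `n`-step transition probability is positive. -/
def Accessible (β p : ℝ) (w w' : Word) : Prop :=
  ∃ n : ℕ, 0 < n ∧ 0 < Pn β p n w w'

/-- Two states communicate: each is accessible from the other. -/
def Communicate (β p : ℝ) (w w' : Word) : Prop :=
  Accessible β p w w' ∧ Accessible β p w' w

instance : MeasurableSpace Word := ⊤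

/-- `ξ` is (a realization of) the discrete-time exclusion-voter Markov chain with
parameters `(β, p)` under the probability measure `μ`. -/
def IsEVChain (β p : ℝ) {Ω : Type*} [MeasurableSpace Ω] (μ : Measure Ω)
    (ξ : ℕ → Ω → Word) : Prop :=
  (∀ t, Measurable (ξ t)) ∧
  ∀ (t : ℕ) (path : ℕ → Word),
    μ {ω | ∀ i ≤ t + 1, ξ i ω = path i}
      = μ {ω | ∀ i ≤ t, ξ i ω = path i} * ENNReal.ofReal (P β p (path t) (path (t + 1)))

/-- The relaxation time `τ = min {t ∈ ℕ, t ≥ 1 : ξ_t = 𝒟₀}` (`∞` if there is no such `t`). -/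
noncomputable def relaxTime {Ω : Type*} (ξ : ℕ → Ω → Word) (ω : Ω) : ℝ≥0∞ :=
  sInf {r : ℝ≥0∞ | ∃ t : ℕ, 0 < t ∧ ξ t ω = groundState ∧ r = (t : ℝ≥0∞)}

/-- The size `|S|` of the hybrid zone. -/
def hz (w : Word) : ℕ := w.length

/-- The number of blocks `N(S)`: the number of (finite) `1`-blocks of the hybrid zone. -/
def nb (w : Word) : ℕ :=
  ((Finset.range w.length).filter
    (fun b => w.getD b false = true ∧ (b = 0 ∨ w.getD (b - 1) true = false))).card

/-- Number of `0`s among the first `c` positions of the hybrid zone. -/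
def z0 (w : Word) (c : ℕ) : ℕ :=
  ((Finset.range c).filter (fun a => w.getD a true = false)).card

/-- Number of `1`s of the hybrid zone at positions `≥ c`. -/
def o1 (w : Word) (c : ℕ) : ℕ :=
  ((Finset.Ico c w.length).filter (fun b => w.getD b false = true)).card

/-- `f₁(S) = Σᵢ mᵢ Rᵢ = Σᵢ nᵢ Tᵢ`: each `1` contributes the number of `0`s to its left. -/
def f1 (w : Word) : ℕ :=
  ∑ b ∈ (Finset.range w.length).filter (fun b => w.getD b false = true), z0 w b

/-- `f₂(S) = (1/2)(Σᵢ mᵢ Rᵢ² + Σᵢ nᵢ Tᵢ²)`: each `1` contributes the squared number of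
`0`s to its left, each `0` the squared number of `1`s to its right. -/
noncomputable def f2 (w : Word) : ℝ :=
  (1 / 2) *
    ((∑ b ∈ (Finset.range w.length).filter (fun b => w.getD b false = true),
        ((z0 w b : ℝ)) ^ 2)
     + (∑ a ∈ (Finset.range w.length).filter (fun a => w.getD a true = false),
        ((o1 w (a + 1) : ℝ)) ^ 2))

/-- `g(S) = max_{1 ≤ k ≤ N} R_k T_k`: the maximum over the `01`-corners of
(number of `0`s up to the corner) × (number of `1`s after the corner). -/
def gfun (w : Word) : ℕ :=
  ((Finset.range w.length).filter
    (fun a => w.getD a true = false ∧ w.getD (a + 1) false = true)).sup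
    (fun a => z0 w (a + 1) * o1 w (a + 1))

/-- `φ₁(S) = Σᵢ Σ_{j=R_{i-1}+1}^{R_i} Σ_{k=1}^{T_i} 1/(j+k)`: the `j`-th `0` (at position `a`,
so `j = z0 w (a+1)`) contributes `Σ_{k=1}^{T} 1/(j+k)` with `T` the number of `1`s to its right. -/
noncomputable def phi1 (w : Word) : ℝ :=
  ∑ a ∈ (Finset.range w.length).filter (fun a => w.getD a true = false),
    ∑ k ∈ Finset.Icc 1 (o1 w (a + 1)), (1 : ℝ) / ((z0 w (a + 1) : ℝ) + (k : ℝ))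


/-- Number of `1`s of a word. -/
noncomputable def ones : Word → ℝ
  | [] => 0
  | true :: l => ones l + 1
  | false :: l => ones l

/-- Number of `0`s of a word. -/
noncomputable def zeros : Word → ℝ
  | [] => 0
  | true :: l => zeros l
  | false :: l => zeros l + 1

/-- Number of inversions (a `0` to the left of a `1`) of a word. -/
noncomputable def inv : Word → ℝ
  | [] => 0
  | true :: l => inv l
  | false :: l => inv l + ones l

/-- Each `1` contributes the square of the number of `0`s to its left, each `0` the square of
the number of `1`s to its right. -/
noncomputable def sqInv : Word → ℝ
  | [] => 0
  | true :: l => sqInv l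
  | false :: l => sqInv l + 2 * inv l + ones l + ones l ^ 2

lemma ones_nonneg (l : Word) : 0 ≤ ones l := by
  induction l with
  | nil => simp [ones]
  | cons a l ih => cases a <;> simp only [ones] <;> linarith

lemma zeros_nonneg (l : Word) : 0 ≤ zeros l := by
  induction l with
  | nil => simp [zeros]
  | cons a l ih => cases a <;> simp only [zeros] <;> linarith

lemma inv_nonneg (l : Word) : 0 ≤ inv l := by
  induction l with
  | nil => simp [inv]
  | cons a l ih => cases a <;> simp only [inv] <;> linarith [ones_nonneg l]

lemma sqInv_nonneg (l : Word) : 0 ≤ sqInv l := by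
  induction l with
  | nil => simp [sqInv]
  | cons a l ih =>
    cases a <;> simp only [sqInv]
    · have := ones_nonneg l
      have := inv_nonneg l
      positivity
    · exact ih

lemma ones_append (u v : Word) : ones (u ++ v) = ones u + ones v := by
  induction u with
  | nil => simp [ones]
  | cons a l ih => cases a <;> simp only [ones, List.cons_append, ih] <;> ring

lemma zeros_append (u v : Word) : zeros (u ++ v) = zeros u + zeros v := by
  induction u with
  | nil => simp [zeros]
  | cons a l ih => cases a <;> simp only [zeros, List.cons_append, ih] <;> ring

lemma inv_append (u v : Word) : inv (u ++ v) = inv u + inv v + zeros u * ones v := by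
  induction u with
  | nil => simp [inv, zeros]
  | cons a l ih =>
    cases a <;> simp only [inv, zeros, List.cons_append, ih, ones_append] <;> ring

lemma sqInv_append (u v : Word) :
    sqInv (u ++ v) = sqInv u + sqInv v + ones v * zeros u ^ 2 + 2 * zeros u * inv v
      + 2 * ones v * inv u + zeros u * ones v ^ 2 := by
  induction u with
  | nil => simp [sqInv, inv, zeros]
  | cons a l ih =>
    cases a <;> simp only [sqInv, inv, zeros, List.cons_append, ih, ones_append, inv_append] <;>
      ring

lemma inv_le_zeros_mul_ones (l : Word) : inv l ≤ zeros l * ones l := by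
  induction l with
  | nil => simp [inv, zeros]
  | cons a l ih =>
    have := zeros_nonneg l
    cases a <;> simp only [inv, zeros, ones] <;> nlinarith

lemma sqInv_le (l : Word) : sqInv l ≤ ones l * zeros l ^ 2 + zeros l * ones l ^ 2 := by
  induction l with
  | nil => simp [sqInv, ones, zeros]
  | cons a l ih =>
    have h0 := zeros_nonneg l
    have h1 := ones_nonneg l
    have h2 := inv_le_zeros_mul_ones l
    cases a <;> simp only [sqInv, zeros, ones]
    · nlinarith
    · have := mul_nonneg h0 h1
      nlinarith [sq_nonneg (zeros l)]

lemma inv_sq_le (l : Word) : inv l ^ 2 ≤ ones l * sqInv l := by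
  induction l with
  | nil => simp [sqInv, ones, inv]
  | cons a l ih =>
    have h1 := ones_nonneg l
    cases a <;> simp only [sqInv, inv, ones]
    · nlinarith [pow_nonneg h1 3]
    · nlinarith [sqInv_nonneg l]

lemma inv_pow_four_le (l : Word) : inv l ^ 4 ≤ sqInv l ^ 3 := by
  induction l with
  | nil => simp [sqInv, inv]
  | cons a l ih =>
    cases a
    · have h := inv_sq_le (false :: l)
      have h1 : ones (false :: l) ^ 2 ≤ sqInv (false :: l) := by
        simp only [ones, sqInv]
        linarith [sqInv_nonneg l, inv_nonneg l, ones_nonneg l]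
      have h2 := sqInv_nonneg (false :: l)
      calc inv (false :: l) ^ 4 = (inv (false :: l) ^ 2) ^ 2 := by ring
        _ ≤ (ones (false :: l) * sqInv (false :: l)) ^ 2 := by gcongr
        _ = ones (false :: l) ^ 2 * sqInv (false :: l) ^ 2 := by ring
        _ ≤ sqInv (false :: l) * sqInv (false :: l) ^ 2 := by gcongr
        _ = sqInv (false :: l) ^ 3 := by ring
    · simpa only [sqInv, inv] using ih

/-- A function of words which is unchanged when the word is extended by a `1` on the left or
by a `0` on the right. -/
def PadInvariant (g : Word → ℝ) : Prop :=
  (∀ l, g (true :: l) = g l) ∧ ∀ l, g (l ++ [false]) = g l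

lemma padInvariant_inv : PadInvariant inv :=
  ⟨fun _ => rfl, fun l => by simp [inv_append, inv, ones]⟩

lemma padInvariant_sqInv : PadInvariant sqInv :=
  ⟨fun _ => rfl, fun l => by simp [sqInv_append, sqInv, inv, ones]⟩

lemma PadInvariant.comp_right {g : Word → ℝ} (hg : PadInvariant g) (φ : ℝ → ℝ) :
    PadInvariant (fun w => φ (g w)) :=
  ⟨fun l => congrArg φ (hg.1 l), fun l => congrArg φ (hg.2 l)⟩

lemma PadInvariant.pad {g : Word → ℝ} (hg : PadInvariant g) (w : Word) :
    g (pad w) = g w := by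
  rw [EV.pad, hg.1, hg.2]

lemma PadInvariant.strip {g : Word → ℝ} (hg : PadInvariant g) (w : Word) :
    g (strip w) = g w := by
  have hleft : ∀ l : Word, g (l.dropWhile (· = true)) = g l := by
    intro l
    induction l with
    | nil => rfl
    | cons a l ih =>
      cases a
      · simp
      · simpa [hg.1] using ih
  have hright : ∀ l : Word, g (l.dropWhile (· = false)).reverse = g l.reverse := by
    intro l
    induction l with
    | nil => rfl
    | cons a l ih =>
      cases a
      · simpa [hg.2] using ih
      · simp
  rw [EV.strip, hright, List.reverse_reverse, hleft]

lemma isConfig_strip (w : Word) : IsConfig (strip w) := by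
  have hhead : ∀ (q : Bool → Bool) (l : Word) (a : Bool),
      (l.dropWhile q).head? = some a → q a = false := by
    intro q l a
    induction l with
    | nil => simp
    | cons b l ih =>
      by_cases hb : q b = true
      · simpa [hb] using ih
      · simp only [List.dropWhile_cons, hb]
        rintro h
        simp only [Bool.false_eq_true, if_false, List.head?_cons, Option.some.injEq] at h
        subst h
        simpa using hb
  by_cases hs : strip w = []
  · exact Or.inl hs
  right
  set t := w.dropWhile (· = true) with ht
  have hst : strip w = (t.reverse.dropWhile (· = false)).reverse := rfl
  have hpre : strip w <+: t := by
    rw [hst]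
    have := List.dropWhile_suffix (l := t.reverse) (· = false)
    simpa using List.reverse_prefix.mpr this
  constructor
  · obtain ⟨s, hs'⟩ := hpre
    cases hc : strip w with
    | nil => exact absurd hc hs
    | cons a l =>
      have := hhead (· = true) w a (by rw [← ht, ← hs', hc]; rfl)
      simpa using this
  · cases hc : (t.reverse.dropWhile (· = false)) with
    | nil => rw [hst, hc] at hs; simp at hs
    | cons a l =>
      have := hhead (· = false) t.reverse a (by rw [hc]; rfl)
      rw [hst, hc]
      simpa using this

/-- The sum over all adjacent pairs `ab` of a word of `ψ a b z o`, where `z` is `k` plus the number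
of `0`s before the pair and `o` the number of `1`s after it. -/
noncomputable def pairSum (ψ : Bool → Bool → ℝ → ℝ → ℝ) : ℝ → Word → ℝ
  | k, a :: b :: l => ψ a b k (ones l) + pairSum ψ (k + if a then 0 else 1) (b :: l)
  | _, _ => 0

lemma pairSum_eq_sum (ψ : Bool → Bool → ℝ → ℝ → ℝ) (a : Bool) (l : Word) (k : ℝ) :
    pairSum ψ k (a :: l) = ∑ i ∈ Finset.range l.length,
      ψ ((a :: l).getD i true) ((a :: l).getD (i + 1) true) (k + zeros ((a :: l).take i))
        (ones ((a :: l).drop (i + 2))) := by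
  induction l generalizing a k with
  | nil => simp [pairSum]
  | cons b l ih =>
    rw [pairSum, ih, List.length_cons, Finset.sum_range_succ', add_comm]
    congr 1
    · refine Finset.sum_congr rfl fun i _ => ?_
      cases a <;> simp [zeros, add_comm, add_left_comm]
    · simp [zeros]

/-- The indicator of the pair `01`. -/
def up (a b : Bool) (_ _ : ℝ) : ℝ := if a = false ∧ b = true then 1 else 0

/-- The indicator of the pair `10`. -/
def down (a b : Bool) (_ _ : ℝ) : ℝ := if a = true ∧ b = false then 1 else 0

lemma pairSum_down (w : Word) (a : Bool) (k : ℝ) :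
    pairSum down k (a :: (w ++ [false])) =
      pairSum up k (a :: (w ++ [false])) + if a then 1 else 0 := by
  induction w generalizing a k with
  | nil => cases a <;> simp [pairSum, up, down]
  | cons b w ih =>
    simp only [List.cons_append, pairSum, ih]
    cases a <;> cases b <;> simp [up, down] <;> ring

lemma pairSum_down_add (w : Word) (a : Bool) (k : ℝ) :
    pairSum (fun a b k o => down a b k o * (k + o)) k (a :: (w ++ [false])) =
      pairSum (fun a b k o => up a b k o * (k + o + 2)) k (a :: (w ++ [false]))
        + if a then k else - ones w := by
  induction w generalizing a k with
  | nil => cases a <;> simp [pairSum, up, down, ones]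
  | cons b w ih =>
    simp only [List.cons_append, pairSum, ih]
    cases a <;> cases b <;> simp [up, down, ones, ones_append] <;> ring

lemma pairSum_mono {ψ φ : Bool → Bool → ℝ → ℝ → ℝ} {k : ℝ} (hk : 0 ≤ k)
    (h : ∀ a b z o, 0 ≤ z → 0 ≤ o → ψ a b z o ≤ φ a b z o) (l : Word) :
    pairSum ψ k l ≤ pairSum φ k l := by
  induction l generalizing k with
  | nil => simp [pairSum]
  | cons a l ih =>
    cases l with
    | nil => simp [pairSum]
    | cons b l =>
      simp only [pairSum]
      exact add_le_add (h _ _ _ _ hk (ones_nonneg _)) (ih (by split_ifs <;> linarith))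

lemma pairSum_zero (k : ℝ) (l : Word) : pairSum (fun _ _ _ _ => 0) k l = 0 := by
  induction l generalizing k with
  | nil => simp [pairSum]
  | cons a l ih =>
    cases l with
    | nil => simp [pairSum]
    | cons b l => simp [pairSum, ih]

lemma pairSum_linear (ψ φ : Bool → Bool → ℝ → ℝ → ℝ) (c d k : ℝ) (l : Word) :
    pairSum (fun a b z o => c * ψ a b z o + d * φ a b z o) k l =
      c * pairSum ψ k l + d * pairSum φ k l := by
  induction l generalizing k with
  | nil => simp [pairSum]
  | cons a l ih =>
    cases l with
    | nil => simp [pairSum]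
    | cons b l => simp only [pairSum, ih]; ring

/-- The sum of `R + T` over the pairs `01`, where `R` is the number of `0`s up to the pair and `T`
the number of `1`s from the pair on. -/
noncomputable def cornerSum (k : ℝ) (l : Word) : ℝ :=
  pairSum (fun a b z o => up a b z o * (z + o + 2)) k l

lemma pairSum_nonneg {ψ : Bool → Bool → ℝ → ℝ → ℝ} {k : ℝ} (hk : 0 ≤ k)
    (h : ∀ a b z o, 0 ≤ z → 0 ≤ o → 0 ≤ ψ a b z o) (l : Word) : 0 ≤ pairSum ψ k l := by
  simpa [pairSum_zero] using pairSum_mono hk h l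

lemma up_nonneg (a b : Bool) (z o : ℝ) : 0 ≤ up a b z o := by
  unfold up; split_ifs <;> norm_num

lemma cornerSum_nonneg {k : ℝ} (hk : 0 ≤ k) (l : Word) : 0 ≤ cornerSum k l :=
  pairSum_nonneg hk (fun a b z o hz ho => mul_nonneg (up_nonneg a b z o) (by linarith)) l

lemma pairSum_up_le_ones (a : Bool) (l : Word) (k : ℝ) : pairSum up k (a :: l) ≤ ones l := by
  induction l generalizing a k with
  | nil => simp [pairSum, ones]
  | cons b l ih =>
    have := ih b (k + if a then 0 else 1)
    cases a <;> cases b <;> simp [pairSum, up, ones] at this ⊢ <;> linarith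

lemma le_cornerSum (l : Word) {k : ℝ} (hk : 0 ≤ k) :
    pairSum up k l * (pairSum up k l + 1) + k * pairSum up k l ≤ cornerSum k l := by
  induction l generalizing k with
  | nil => simp [pairSum, cornerSum]
  | cons a l ih =>
    cases l with
    | nil => simp [pairSum, cornerSum]
    | cons b l =>
      have hk' : 0 ≤ k + if a then 0 else 1 := by split_ifs <;> linarith
      have h := ih hk'
      have h1 := pairSum_up_le_ones b l (k + if a then 0 else 1)
      have h2 := pairSum_nonneg hk' (fun a b z o _ _ => up_nonneg a b z o) (b :: l)
      simp only [cornerSum, pairSum] at h ⊢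
      set S := pairSum up (k + if a then 0 else 1) (b :: l)
      cases a <;> cases b <;> simp [up] at h ⊢ <;> nlinarith

lemma add_ones_le_cornerSum (w : Word) {k : ℝ} (hk : 0 ≤ k) (hw : 0 < ones w) :
    k + ones w ≤ cornerSum k (false :: (w ++ [false])) := by
  induction w generalizing k with
  | nil => simp [ones] at hw
  | cons b w ih =>
    have hk' : 0 ≤ k + 1 := by linarith
    cases b
    · have := ih hk' hw
      simp [cornerSum, pairSum, up, ones] at this ⊢
      linarith
    · have := cornerSum_nonneg hk' (true :: (w ++ [false]))
      simp [cornerSum, pairSum, up, ones, ones_append] at this ⊢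
      linarith

lemma one_le_pairSum_up (w : Word) {k : ℝ} (hk : 0 ≤ k) (hw : 0 < ones w) :
    1 ≤ pairSum up k (false :: (w ++ [false])) := by
  induction w generalizing k with
  | nil => simp [ones] at hw
  | cons b w ih =>
    have hk' : 0 ≤ k + 1 := by linarith
    cases b
    · have := ih hk' hw
      simpa [pairSum, up, ones] using this
    · have := pairSum_nonneg hk' (fun a b z o _ _ => up_nonneg a b z o) (true :: (w ++ [false]))
      simpa [pairSum, up, ones] using this

lemma add_zeros_le_cornerSum (w : Word) (a : Bool) {k : ℝ} (hk : 0 ≤ k)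
    (hw : 0 < zeros (a :: w)) :
    k + zeros (a :: w) ≤ cornerSum k (a :: (w ++ [true, false])) := by
  induction w generalizing a k with
  | nil => cases a <;> simp [cornerSum, pairSum, up, ones, zeros] at hw ⊢
  | cons b w ih =>
    have hk' : 0 ≤ k + if a then 0 else 1 := by split_ifs <;> linarith
    have h1 := cornerSum_nonneg hk' (b :: (w ++ [true, false]))
    have h2 := ones_nonneg w
    have h4 := zeros_nonneg w
    rcases (zeros_nonneg (b :: w)).eq_or_lt with h3 | h3
    · cases a <;> cases b <;> simp [cornerSum, pairSum, up, ones, zeros, ones_append] at * <;>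
        linarith
    · have h5 := ih b hk' h3
      cases a <;> cases b <;> simp [cornerSum, pairSum, up, ones, zeros, ones_append] at * <;>
        linarith

/-- The indices of the unlike adjacent pairs, as a finset. -/
def unlikeSet (w : Word) : Finset ℕ :=
  (Finset.range (w.length + 1)).filter
    (fun i => (pad w).getD i true ≠ (pad w).getD (i + 1) true)

/-- The probability that the exclusion move at the unlike pair with index `i` is a swap. -/
noncomputable def swapProb (p : ℝ) (w : Word) (i : ℕ) : ℝ :=
  if (pad w).getD i true then 1 - p else p

/-- The mean of `g` after a move at the unlike pair with index `i`. -/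
noncomputable def moveMean (β p : ℝ) (g : Word → ℝ) (w : Word) (i : ℕ) : ℝ :=
  β * (1 / 2) * g (strip (setPair (pad w) i false false))
    + β * (1 / 2) * g (strip (setPair (pad w) i true true))
    + (1 - β) * swapProb p w i * g (strip (swapPair (pad w) i))
    + (1 - β) * (1 - swapProb p w i) * g w

/-- The mean of `g` after one step of the chain from `w`. -/
noncomputable def stepMean (β p : ℝ) (g : Word → ℝ) (w : Word) : ℝ :=
  ∑ i ∈ unlikeSet w, ((unlike w).length : ℝ)⁻¹ * moveMean β p g w i

lemma sum_map_unlike (w : Word) (f : ℕ → ℝ) :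
    ((unlike w).map f).sum = ∑ i ∈ unlikeSet w, f i := by
  rw [unlikeSet, Finset.sum_filter, unlike]
  generalize w.length + 1 = n
  induction n with
  | zero => simp
  | succ n ih =>
    rw [List.range_succ, List.filter_append, List.map_append, List.sum_append, ih,
      Finset.sum_range_succ]
    congr 1
    by_cases h : (pad w).getD n true ≠ (pad w).getD (n + 1) true
    · rw [if_pos h, List.filter_cons, if_pos (decide_eq_true h)]; simp
    · rw [if_neg h, List.filter_cons_of_neg (by rwa [decide_eq_true_iff])]; simp

lemma P_eq_stepMean (β p : ℝ) (w w' : Word) :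
    P β p w w' = stepMean β p (fun x => if x = w' then 1 else 0) w := by
  rw [P, sum_map_unlike]
  rfl

lemma length_unlike (w : Word) : ((unlike w).length : ℝ) = ∑ _i ∈ unlikeSet w, (1 : ℝ) := by
  rw [← sum_map_unlike w (fun _ => (1 : ℝ))]
  simp

lemma swapProb_mem (p : ℝ) (hp0 : 0 ≤ p) (hp1 : p ≤ 1) (w : Word) (i : ℕ) :
    0 ≤ swapProb p w i ∧ swapProb p w i ≤ 1 := by
  unfold swapProb; split_ifs <;> constructor <;> linarith

lemma stepMean_mono {β p : ℝ} (hβ0 : 0 ≤ β) (hβ1 : β ≤ 1) (hp0 : 0 ≤ p) (hp1 : p ≤ 1)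
    {g h : Word → ℝ} (hgh : ∀ x, g x ≤ h x) (w : Word) :
    stepMean β p g w ≤ stepMean β p h w := by
  refine Finset.sum_le_sum fun i _ => ?_
  obtain ⟨h0, h1⟩ := swapProb_mem p hp0 hp1 w i
  have : 0 ≤ 1 - β := by linarith
  have : 0 ≤ 1 - swapProb p w i := by linarith
  unfold moveMean
  gcongr <;> exact hgh _

lemma stepMean_linear (β p c d : ℝ) (g h : Word → ℝ) (w : Word) :
    stepMean β p (fun x => c * g x + d * h x) w =
      c * stepMean β p g w + d * stepMean β p h w := by
  simp only [stepMean, moveMean, Finset.mul_sum, ← Finset.sum_add_distrib]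
  exact Finset.sum_congr rfl fun i _ => by ring

lemma pairSum_up_nonneg (w : Word) : 0 ≤ pairSum up 0 (pad w) :=
  pairSum_nonneg le_rfl (fun a b z o _ _ => up_nonneg a b z o) _

/-- A sum over the unlike pairs of a word is a sum over all pairs of the padded word. -/
lemma sum_unlikeSet (w : Word) (ψ : Bool → Bool → ℝ → ℝ → ℝ) :
    ∑ i ∈ unlikeSet w, ψ ((pad w).getD i true) ((pad w).getD (i + 1) true)
        (zeros ((pad w).take i)) (ones ((pad w).drop (i + 2))) =
      pairSum (fun a b z o => if a ≠ b then ψ a b z o else 0) 0 (pad w) := by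
  rw [unlikeSet, Finset.sum_filter, pad, pairSum_eq_sum]
  simp

lemma length_unlike_eq (w : Word) :
    ((unlike w).length : ℝ) = 2 * pairSum up 0 (pad w) + 1 := by
  have h := sum_unlikeSet w (fun _ _ _ _ => 1)
  rw [length_unlike, h]
  have h2 := pairSum_linear up down 1 1 0 (pad w)
  have h3 := pairSum_down w true 0
  rw [← pad] at h3
  rw [h3] at h2
  simp only [if_true] at h2
  have h4 : (fun a b z o => 1 * up a b z o + 1 * down a b z o) =
      fun a b (_ _ : ℝ) => if a ≠ b then (1 : ℝ) else 0 := by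
    funext a b z o
    cases a <;> cases b <;> simp [up, down]
  rw [h4] at h2
  rw [h2]; ring

lemma stepMean_const (β p c : ℝ) (w : Word) : stepMean β p (fun _ => c) w = c := by
  have h : ∀ i, moveMean β p (fun _ => c) w i = c := fun i => by unfold moveMean; ring
  simp only [stepMean, h]
  rw [← Finset.mul_sum, Finset.sum_const, nsmul_eq_mul]
  have h1 : ((unlike w).length : ℝ) = (unlikeSet w).card := by simp [length_unlike]
  have h2 := length_unlike_eq w
  have h3 := pairSum_up_nonneg w
  have h4 : ((unlike w).length : ℝ) ≠ 0 := by rw [h2]; positivity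
  rw [← h1]
  field_simp

/-- If the mean change of a padding invariant `g` under a move at an unlike pair `ab` is bounded by
a local expression `ψ`, then the mean change of `g` in one step is bounded by the average of `ψ`
over the unlike pairs. -/
lemma stepMean_le {β p : ℝ} {g : Word → ℝ} (hg : PadInvariant g)
    (w : Word) (ψ : Bool → Bool → ℝ → ℝ → ℝ)
    (h : ∀ (u v : Word) (a b : Bool), a ≠ b → u ++ a :: b :: v = pad w →
      β * (1 / 2) * g (u ++ false :: false :: v) + β * (1 / 2) * g (u ++ true :: true :: v)
        + (1 - β) * (if a then 1 - p else p) * g (u ++ b :: a :: v)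
        + (1 - β) * (1 - if a then 1 - p else p) * g (u ++ a :: b :: v)
      ≤ g (u ++ a :: b :: v) + ψ a b (zeros u) (ones v)) :
    stepMean β p g w ≤ g w + (2 * pairSum up 0 (pad w) + 1)⁻¹ *
      pairSum (fun a b z o => if a ≠ b then ψ a b z o else 0) 0 (pad w) := by
  rw [← sum_unlikeSet, ← length_unlike_eq]
  conv_rhs => enter [1]; rw [← stepMean_const β p (g w) w]
  rw [Finset.mul_sum, stepMean, stepMean, ← Finset.sum_add_distrib]
  refine Finset.sum_le_sum fun i hi => ?_
  rw [← mul_add]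
  refine mul_le_mul_of_nonneg_left ?_ (by positivity)
  simp only [unlikeSet, Finset.mem_filter, Finset.mem_range] at hi
  obtain ⟨hi, hne⟩ := hi
  have hlen : (pad w).length = w.length + 2 := by simp [pad]
  have hi0 : i < (pad w).length := by omega
  have hi1 : i + 1 < (pad w).length := by omega
  set u := (pad w).take i with hu
  set v := (pad w).drop (i + 2) with hv
  set a := (pad w).getD i true with ha
  set b := (pad w).getD (i + 1) true with hb
  have hdec : u ++ a :: b :: v = pad w := by
    rw [hu, hv, ha, hb, List.getD_eq_getElem _ _ hi0, List.getD_eq_getElem _ _ hi1,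
      ← List.drop_eq_getElem_cons, ← List.drop_eq_getElem_cons, List.take_append_drop]
  have hul : u.length = i := by rw [hu, List.length_take]; omega
  have hset : ∀ c d, setPair (pad w) i c d = u ++ c :: d :: v := by
    intro c d
    rw [setPair, ← hdec, List.set_append_right _ _ (by omega),
      List.set_append_right _ _ (by omega)]
    simp [hul]
  have hswap : swapPair (pad w) i = u ++ b :: a :: v := by
    rw [swapPair, hset]
  have hc : moveMean β p (fun _ => g w) w i = g w := by unfold moveMean; ring
  have := h u v a b hne hdec
  rw [hc]
  unfold moveMean
  rw [hg.strip, hg.strip, hg.strip, hset, hset, hswap, ← hg.pad w, ← hdec]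
  exact this

lemma stepMean_inv_le (p : ℝ) (w : Word) :
    stepMean 1 p inv w ≤
      inv w - pairSum up 0 (pad w) / (2 * pairSum up 0 (pad w) + 1) := by
  have h := stepMean_le (β := 1) (p := p) padInvariant_inv w (fun a b z o => - up a b z o) (by
    intro u v a b hab _
    apply le_of_eq
    cases a <;> cases b <;> simp [inv_append, inv, ones, up] at hab ⊢ <;> ring)
  have h2 := pairSum_linear up up (-1) 0 0 (pad w)
  have h3 : (fun a b z o => if a ≠ b then - up a b z o else 0) =
      fun a b z o => (-1) * up a b z o + 0 * up a b z o := by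
    funext a b z o
    cases a <;> cases b <;> simp [up]
  rw [h3, h2] at h
  refine h.trans_eq ?_
  field_simp
  ring

lemma stepMean_sqInv_le {β p : ℝ} (hβ1 : β ≤ 1) (hp0 : 0 ≤ p)
    (w : Word) :
    stepMean β p sqInv w ≤ sqInv w
      + (1 - β) * (2 - 2 * (2 * p - 1) * cornerSum 0 (pad w) / (2 * pairSum up 0 (pad w) + 1)) := by
  have h := stepMean_le (β := β) (p := p) padInvariant_sqInv w
    (fun a b z o => if a then β * (z + o) + (1 - β) * (1 - p) * (2 * (z + o) + 2) else
      - (β * (z + o + 2)) + (1 - β) * p * (2 - 2 * (z + o + 2))) (by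
    intro u v a b hab _
    apply le_of_eq
    cases a <;> cases b <;>
      simp [sqInv_append, sqInv, inv, ones] at hab ⊢ <;> ring)
  have h1 := pairSum_linear up down (2 * (1 - β) * p) (2 * (1 - β) * (1 - p)) 0 (pad w)
  have h2 := pairSum_linear (fun a b z o => down a b z o * (z + o))
    (fun a b z o => up a b z o * (z + o + 2)) (β + 2 * (1 - β) * (1 - p))
    (-(β + 2 * (1 - β) * p)) 0 (pad w)
  have h3 := pairSum_linear
    (fun a b z o => 2 * (1 - β) * p * up a b z o + 2 * (1 - β) * (1 - p) * down a b z o)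
    (fun a b z o => (β + 2 * (1 - β) * (1 - p)) * (down a b z o * (z + o)) +
      (-(β + 2 * (1 - β) * p)) * (up a b z o * (z + o + 2))) 1 1 0 (pad w)
  have h4 := pairSum_down w true 0
  have h5 := pairSum_down_add w true 0
  rw [← pad] at h4 h5
  rw [h1, h2, h4, h5] at h3
  simp only [if_true] at h3
  rw [← cornerSum] at h3
  have hN := pairSum_up_nonneg w
  set N := pairSum up 0 (pad w)
  set X := cornerSum 0 (pad w)
  have h6 : (fun a b z o => if a ≠ b then
      (if a then β * (z + o) + (1 - β) * (1 - p) * (2 * (z + o) + 2) else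
        - (β * (z + o + 2)) + (1 - β) * p * (2 - 2 * (z + o + 2))) else 0) =
      fun a b z o => 1 * (2 * (1 - β) * p * up a b z o + 2 * (1 - β) * (1 - p) * down a b z o) +
        1 * ((β + 2 * (1 - β) * (1 - p)) * (down a b z o * (z + o)) +
          (-(β + 2 * (1 - β) * p)) * (up a b z o * (z + o + 2))) := by
    funext a b z o
    cases a <;> cases b <;> simp [up, down] <;> ring
  rw [h6, h3] at h
  refine h.trans ?_
  have h7 : 0 ≤ (1 - β) * (p + N) := mul_nonneg (by linarith) (by linarith)
  have h8 : (2 * N + 1)⁻¹ * (2 * ((1 - β) * (p + N))) ≥ 0 := by positivity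
  have h9 : (1 - β) * (2 - 2 * (2 * p - 1) * X / (2 * N + 1)) -
      (2 * N + 1)⁻¹ * (1 * (2 * (1 - β) * p * N + 2 * (1 - β) * (1 - p) * (N + 1)) +
        1 * ((β + 2 * (1 - β) * (1 - p)) * (X + 0) + -(β + 2 * (1 - β) * p) * X)) =
      (2 * N + 1)⁻¹ * (2 * ((1 - β) * (p + N))) := by
    field_simp
    ring
  linarith

lemma stepMean_neg_exp_le {β p l : ℝ} (hβ0 : 0 ≤ β) (hβ1 : β ≤ 1) (hp0 : 0 ≤ p) (hp1 : p ≤ 1)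
    (w : Word) (hw : 1 ≤ pairSum up 0 (pad w)) :
    stepMean β p (fun x => - Real.exp (-(l * inv x))) w ≤
      - ((1 - β) * p / 3 * Real.exp l * Real.exp (-(l * inv w))) := by
  have hβ : 0 ≤ 1 - β := by linarith
  have h := stepMean_le (β := β) (p := p)
    (padInvariant_inv.comp_right (fun y => - Real.exp (-(l * y)))) w
    (fun a b z o => Real.exp (-(l * inv w)) +
      up a b z o * (- ((1 - β) * p * Real.exp l * Real.exp (-(l * inv w))))) (by
    intro u v a b hab hdec
    have hw : inv w = inv (u ++ a :: b :: v) := by rw [hdec, padInvariant_inv.pad]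
    rw [hw]
    have h1 : 0 ≤ β * (1 / 2) * Real.exp (-(l * inv (u ++ false :: false :: v))) := by positivity
    have h2 : 0 ≤ β * (1 / 2) * Real.exp (-(l * inv (u ++ true :: true :: v))) := by positivity
    have h3 : 0 ≤ (1 - β) * (1 - if a then 1 - p else p) *
        Real.exp (-(l * inv (u ++ a :: b :: v))) := by
      refine mul_nonneg (mul_nonneg hβ ?_) (Real.exp_pos _).le
      split_ifs <;> linarith
    have h4 : up a b (zeros u) (ones v) * ((1 - β) * p * Real.exp l *
          Real.exp (-(l * inv (u ++ a :: b :: v)))) ≤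
        (1 - β) * (if a then 1 - p else p) * Real.exp (-(l * inv (u ++ b :: a :: v))) := by
      by_cases hup : a = false ∧ b = true
      · obtain ⟨rfl, rfl⟩ := hup
        have : -(l * inv (u ++ true :: false :: v)) =
            l + -(l * inv (u ++ false :: true :: v)) := by
          simp only [inv_append, inv, ones]; ring
        rw [this, Real.exp_add]
        simp only [up, and_self, if_true, Bool.false_eq_true, if_false]
        apply le_of_eq; ring
      · rw [up, if_neg hup, zero_mul]
        refine mul_nonneg (mul_nonneg hβ ?_) (Real.exp_pos _).le
        split_ifs <;> linarith
    linarith)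
  set N := pairSum up 0 (pad w)
  set E := Real.exp (-(l * inv w)) with hE
  have h1 := pairSum_linear up down (E + (- ((1 - β) * p * Real.exp l * E))) E 0 (pad w)
  have h2 := pairSum_down w true 0
  rw [← pad] at h2
  rw [h2] at h1
  simp only [if_true] at h1
  have h3 : (fun a b z o => if a ≠ b then
      (E + up a b z o * (- ((1 - β) * p * Real.exp l * E))) else 0) =
      fun a b z o => (E + (- ((1 - β) * p * Real.exp l * E))) * up a b z o + E * down a b z o := by
    funext a b z o
    cases a <;> cases b <;> simp [up, down]
  rw [h3, h1] at h
  refine h.trans ?_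
  have hD : 0 ≤ (1 - β) * p * Real.exp l * E := by positivity
  set D := (1 - β) * p * Real.exp l * E with hDdef
  have h5 : (1 - β) * p / 3 * Real.exp l * E = D / 3 := by rw [hDdef]; ring
  rw [h5]
  have h6 : -E + (2 * N + 1)⁻¹ * ((E + -D) * N + E * (N + 1)) = - (D * (N / (2 * N + 1))) := by
    field_simp
    ring
  have h7 : (1 : ℝ) / 3 ≤ N / (2 * N + 1) := by
    rw [div_le_div_iff₀ (by norm_num) (by linarith)]; linarith
  have h8 := mul_le_mul_of_nonneg_left h7 hD
  change -E + (2 * N + 1)⁻¹ * ((E + -D) * N + E * (N + 1)) ≤ _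
  rw [h6]
  linarith

lemma exists_append_of_isConfig {w : Word} (hw : IsConfig w) (hne : w ≠ []) :
    (∃ t, w = false :: t ∧ 1 ≤ ones t) ∧ ∃ t, w = t ++ [true] := by
  rcases hw with rfl | ⟨hh, hl⟩
  · exact absurd rfl hne
  have hr : ∃ t, w = t ++ [true] := by
    obtain ⟨t, ht⟩ := List.getLast?_eq_some_iff.mp hl
    exact ⟨t, ht⟩
  refine ⟨?_, hr⟩
  obtain ⟨s, hs⟩ := hr
  obtain ⟨t, ht⟩ := List.head?_eq_some_iff.mp hh
  refine ⟨t, ht, ?_⟩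
  have h1 : ones w = ones t := by rw [ht, ones]
  have h2 : ones w = ones s + 1 := by rw [hs, ones_append]; simp [ones]
  linarith [ones_nonneg s]

lemma inv_pos {w : Word} (hw : IsConfig w) (hne : w ≠ []) : 0 < inv w := by
  obtain ⟨⟨t, rfl, ht⟩, _⟩ := exists_append_of_isConfig hw hne
  simp only [inv]
  linarith [inv_nonneg t]

lemma sqInv_pos {w : Word} (hw : IsConfig w) (hne : w ≠ []) : 0 < sqInv w := by
  obtain ⟨⟨t, rfl, ht⟩, _⟩ := exists_append_of_isConfig hw hne
  simp only [sqInv]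
  nlinarith [inv_nonneg t, sqInv_nonneg t]

lemma one_le_pairSum_up_pad {w : Word} (hw : IsConfig w) (hne : w ≠ []) :
    1 ≤ pairSum up 0 (pad w) := by
  obtain ⟨⟨t, rfl, ht⟩, _⟩ := exists_append_of_isConfig hw hne
  have := one_le_pairSum_up t (le_refl (0 : ℝ)) (by linarith)
  simpa [pad, pairSum, up] using this

lemma ones_le_cornerSum_pad {w : Word} (hw : IsConfig w) (hne : w ≠ []) :
    ones w ≤ cornerSum 0 (pad w) := by
  obtain ⟨⟨t, rfl, ht⟩, _⟩ := exists_append_of_isConfig hw hne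
  have := add_ones_le_cornerSum t (le_refl (0 : ℝ)) (by linarith)
  simpa [pad, pairSum, up, cornerSum, ones] using this

lemma zeros_le_cornerSum_pad {w : Word} (hw : IsConfig w) (hne : w ≠ []) :
    zeros w ≤ cornerSum 0 (pad w) := by
  obtain ⟨⟨t, ht, _⟩, s, hs⟩ := exists_append_of_isConfig hw hne
  have h1 : zeros w = zeros s := by rw [hs, zeros_append]; simp [zeros]
  have h2 : 0 < zeros s := by
    rw [← h1, ht, zeros]
    linarith [zeros_nonneg t]
  have := add_zeros_le_cornerSum s true (le_refl (0 : ℝ)) h2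
  rw [h1, hs]
  simpa [pad, zeros] using this

/-- The drift condition for a Lyapunov function that yields finite relaxation moments of
order `6/5`. -/
def IsLyapunov (β p : ℝ) (V : Word → ℝ) (c : ℝ) : Prop :=
  (∀ w, 0 ≤ V w) ∧ 0 < c ∧ ∀ w, IsConfig w → w ≠ [] →
    0 < V w ∧ stepMean β p V w ≤ V w - c * V w ^ ((1 : ℝ) / 6)

lemma exists_isLyapunov_voter {p : ℝ} (hp0 : 0 ≤ p) (hp1 : p ≤ 1) :
    ∃ V c, IsLyapunov 1 p V c := by
  refine ⟨fun w => inv w ^ ((2 : ℝ) / 5) * sqInv w ^ ((3 : ℝ) / 5), 2 / 15, fun w => ?_,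
    by norm_num, fun w hw hne => ?_⟩
  · have := inv_nonneg w
    have := sqInv_nonneg w
    positivity
  have hx := inv_pos hw hne
  have hy := sqInv_pos hw hne
  have hN := one_le_pairSum_up_pad hw hne
  have h1 := stepMean_inv_le p w
  have h2 := stepMean_sqInv_le (β := 1) le_rfl hp0 w
  have h4 := inv_pow_four_le w
  set N := pairSum up 0 (pad w)
  set x := inv w with hxdef
  set y := sqInv w with hydef
  set V := x ^ ((2 : ℝ) / 5) * y ^ ((3 : ℝ) / 5) with hV
  have hVpos : 0 < V := by positivity
  refine ⟨hVpos, ?_⟩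
  have hle : ∀ u, inv u ^ ((2 : ℝ) / 5) * sqInv u ^ ((3 : ℝ) / 5) ≤
      (V * (2 / 5) / x) * inv u + (V * (3 / 5) / y) * sqInv u := by
    intro u
    have hu := inv_nonneg u
    have hu' := sqInv_nonneg u
    have := Real.geom_mean_le_arith_mean2_weighted (w₁ := 2 / 5) (w₂ := 3 / 5)
      (p₁ := inv u / x) (p₂ := sqInv u / y) (by norm_num) (by norm_num) (by positivity)
      (by positivity) (by norm_num)
    rw [Real.div_rpow hu hx.le, Real.div_rpow hu' hy.le, div_mul_div_comm, ← hV,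
      div_le_iff₀ hVpos] at this
    refine this.trans_eq ?_
    ring
  have h5 := stepMean_mono (β := 1) zero_le_one le_rfl hp0 hp1 hle w
  rw [stepMean_linear] at h5
  have h6 : (1 : ℝ) / 3 ≤ N / (2 * N + 1) := by
    rw [div_le_div_iff₀ (by norm_num) (by linarith)]; linarith
  have h7 : stepMean 1 p inv w ≤ x - 1 / 3 := by linarith
  have h8 : stepMean 1 p sqInv w ≤ y := by simpa using h2
  have h9 : x ≤ V ^ ((5 : ℝ) / 6) := by
    have e1 : V ^ ((5 : ℝ) / 6) = x ^ ((1 : ℝ) / 3) * y ^ ((1 : ℝ) / 2) := by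
      rw [hV, Real.mul_rpow (by positivity) (by positivity), ← Real.rpow_mul hx.le,
        ← Real.rpow_mul hy.le]
      norm_num
    have e2 : x ^ ((2 : ℝ) / 3) ≤ y ^ ((1 : ℝ) / 2) := by
      have e3 : (x ^ 4) ^ ((1 : ℝ) / 6) ≤ (y ^ 3) ^ ((1 : ℝ) / 6) :=
        Real.rpow_le_rpow (by positivity) h4 (by norm_num)
      rw [← Real.rpow_natCast, ← Real.rpow_natCast, ← Real.rpow_mul hx.le,
        ← Real.rpow_mul hy.le] at e3
      norm_num at e3 ⊢
      exact e3
    rw [e1]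
    calc x = x ^ ((1 : ℝ) / 3) * x ^ ((2 : ℝ) / 3) := by
          rw [← Real.rpow_add hx]; norm_num
      _ ≤ _ := by gcongr
  have h10 : V ^ ((1 : ℝ) / 6) * x ≤ V := by
    calc V ^ ((1 : ℝ) / 6) * x ≤ V ^ ((1 : ℝ) / 6) * V ^ ((5 : ℝ) / 6) := by gcongr
      _ = V := by rw [← Real.rpow_add hVpos]; norm_num
  have h11 : V ^ ((1 : ℝ) / 6) ≤ V / x := by rwa [le_div_iff₀ hx]
  refine h5.trans ?_
  calc V * (2 / 5) / x * stepMean 1 p inv w + V * (3 / 5) / y * stepMean 1 p sqInv w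
      ≤ V * (2 / 5) / x * (x - 1 / 3) + V * (3 / 5) / y * y := by gcongr
    _ = V - 2 / 15 * (V / x) := by field_simp; ring
    _ ≤ _ := by linarith

set_option maxHeartbeats 400000 in
lemma exists_isLyapunov_of_lt_one {β p : ℝ} (hβ0 : 0 ≤ β) (hβ1 : β < 1) (hp : 1 / 2 < p)
    (hp1 : p ≤ 1) : ∃ V c, IsLyapunov β p V c := by
  have hβ : 0 < 1 - β := by linarith
  have hp0 : 0 < p := by linarith
  have hp' : 0 < 2 * p - 1 := by linarith
  set κ := (1 - β) * (2 * p - 1) * (2 / 3) with hκ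
  have hκ0 : 0 < κ := by positivity
  set δ := (1 - β) * p / 3 with hδ
  have hδ0 : 0 < δ := by positivity
  set l := Real.log (2 / δ) with hl
  have hel : δ * Real.exp l = 2 := by
    rw [hl, Real.exp_log (by positivity)]; field_simp
  have hl0 : 0 ≤ l := by
    refine Real.log_nonneg ?_
    rw [le_div_iff₀ hδ0, hδ]
    nlinarith
  set K := 2 * Real.exp (l * (4 / κ) ^ 4) with hK
  have hK0 : 0 < K := by positivity
  have hexp1 : ∀ w, Real.exp (-(l * inv w)) ≤ 1 := fun w => by
    rw [Real.exp_le_one_iff]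
    have := mul_nonneg hl0 (inv_nonneg w)
    linarith
  set V : Word → ℝ := fun w => 1 * sqInv w + K * (1 * 1 + 1 * - Real.exp (-(l * inv w))) with hV
  have hVle : ∀ w, sqInv w ≤ V w := fun w => by
    have := mul_nonneg hK0.le (sub_nonneg.mpr (hexp1 w))
    simp only [hV]
    linarith
  refine ⟨V, κ / 2 / (2 + K) ^ ((1 : ℝ) / 6), fun w => (sqInv_nonneg w).trans (hVle w),
    by positivity, fun w hw hne => ⟨(sqInv_pos hw hne).trans_le (hVle w), ?_⟩⟩
  have hN := one_le_pairSum_up_pad hw hne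
  have h1 := stepMean_sqInv_le (β := β) (p := p) hβ1.le hp0.le w
  have h2 := stepMean_neg_exp_le (l := l) hβ0 hβ1.le hp0.le hp1 w hN
  have h3 : stepMean β p V w = stepMean β p sqInv w +
      K * (1 + stepMean β p (fun x => - Real.exp (-(l * inv x))) w) := by
    rw [hV, stepMean_linear, stepMean_linear, stepMean_const]; ring
  have hX1 := le_cornerSum (pad w) (le_refl (0 : ℝ))
  have hXo := ones_le_cornerSum_pad hw hne
  have hXz := zeros_le_cornerSum_pad hw hne
  have ho := ones_nonneg w
  have hz := zeros_nonneg w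
  have hf2 := sqInv_le w
  have hf1 := inv_le_zeros_mul_ones w
  rw [← hδ, hel] at h2
  set N := pairSum up 0 (pad w)
  set X := cornerSum 0 (pad w)
  set E := Real.exp (-(l * inv w)) with hE
  have hE0 : 0 < E := Real.exp_pos _
  have hX : 1 ≤ X := by nlinarith
  have hX0 : 0 ≤ X := by linarith
  set s := Real.sqrt X with hs
  have hs0 : 0 < s := Real.sqrt_pos.mpr (by linarith)
  have hss : s ^ 2 = X := Real.sq_sqrt hX0
  have hNs : N ≤ s := Real.le_sqrt_of_sq_le (by nlinarith)
  have hXN : s / 3 ≤ X / (2 * N + 1) := by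
    rw [div_le_div_iff₀ (by norm_num) (by linarith), ← hss]
    nlinarith
  have hdrift : stepMean β p sqInv w ≤ sqInv w + (2 - κ * s) := by
    refine h1.trans (add_le_add le_rfl ?_)
    have e1 : 2 * (2 * p - 1) * X / (2 * N + 1) = 2 * (2 * p - 1) * (X / (2 * N + 1)) := by ring
    have e2 : 2 * (2 * p - 1) * (s / 3) ≤ 2 * (2 * p - 1) * (X / (2 * N + 1)) := by gcongr
    calc (1 - β) * (2 - 2 * (2 * p - 1) * X / (2 * N + 1))
        ≤ (1 - β) * (2 - 2 * (2 * p - 1) * (s / 3)) := by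
          rw [e1]; gcongr
      _ = (1 - β) * 2 - κ * s := by rw [hκ]; ring
      _ ≤ _ := by linarith
  have hroot : V w ^ ((1 : ℝ) / 6) ≤ (2 + K) ^ ((1 : ℝ) / 6) * s := by
    have e0 : sqInv w ≤ 2 * X ^ 3 := by
      calc sqInv w ≤ ones w * zeros w ^ 2 + zeros w * ones w ^ 2 := hf2
        _ ≤ X * X ^ 2 + X * X ^ 2 := by gcongr
        _ = _ := by ring
    have e1 : V w ≤ (2 + K) * X ^ 3 := by
      have e2 : K ≤ K * X ^ 3 := le_mul_of_one_le_right hK0.le (one_le_pow₀ hX)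
      have e3 := mul_pos hK0 hE0
      calc V w = sqInv w + K - K * E := by simp only [hV]; ring
        _ ≤ 2 * X ^ 3 + K * X ^ 3 := by linarith
        _ = _ := by ring
    have e2 : (X ^ 3) ^ ((1 : ℝ) / 6) = s := by
      rw [hs, Real.sqrt_eq_rpow, ← Real.rpow_natCast, ← Real.rpow_mul hX0]
      norm_num
    calc V w ^ ((1 : ℝ) / 6) ≤ ((2 + K) * X ^ 3) ^ ((1 : ℝ) / 6) :=
          Real.rpow_le_rpow ((sqInv_nonneg w).trans (hVle w)) e1 (by norm_num)
      _ = _ := by rw [Real.mul_rpow (by positivity) (by positivity), e2]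
  have hmain : κ / 2 * s ≤ κ * s - 2 + K * E := by
    by_cases hbig : 4 / κ ≤ s
    · rw [div_le_iff₀ hκ0] at hbig
      have := mul_pos hK0 hE0
      linarith
    · push Not at hbig
      have e1 : inv w ≤ (4 / κ) ^ 4 := by
        calc inv w ≤ zeros w * ones w := hf1
          _ ≤ X * X := by gcongr
          _ = s ^ 4 := by rw [← hss]; ring
          _ ≤ _ := by gcongr
      have e2 : Real.exp (-(l * (4 / κ) ^ 4)) ≤ E := by
        rw [hE]; gcongr
      have e3 : 2 = K * Real.exp (-(l * (4 / κ) ^ 4)) := by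
        rw [hK, mul_assoc, ← Real.exp_add]; simp
      have e4 : 2 ≤ K * E := by rw [e3]; gcongr
      have := mul_pos hκ0 hs0
      linarith
  have hfin : κ / 2 / (2 + K) ^ ((1 : ℝ) / 6) * V w ^ ((1 : ℝ) / 6) ≤ κ / 2 * s := by
    calc κ / 2 / (2 + K) ^ ((1 : ℝ) / 6) * V w ^ ((1 : ℝ) / 6)
        ≤ κ / 2 / (2 + K) ^ ((1 : ℝ) / 6) * ((2 + K) ^ ((1 : ℝ) / 6) * s) := by gcongr
      _ = _ := by field_simp
  have hK2 : K * (1 + stepMean β p (fun x => - Real.exp (-(l * inv x))) w) ≤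
      K * (1 + -(2 * E)) := by gcongr
  have hVw : V w = sqInv w + K * (1 - E) := by simp only [hV]; ring
  rw [h3]
  linarith

/-- Tangent bound for the concave function `y ↦ (y ^ (5/6) + s) ^ (6/5)`. -/
lemma rpow_add_rpow_le {v y s : ℝ} (hv : 0 < v) (hy : 0 ≤ y) (hs : 0 < s) :
    (y ^ ((5 : ℝ) / 6) + s) ^ ((6 : ℝ) / 5) ≤
      (v ^ ((5 : ℝ) / 6) + s) ^ ((1 : ℝ) / 5) * (s + v ^ (-(1 : ℝ) / 6) * y) := by
  set A := v ^ ((5 : ℝ) / 6) + s with hA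
  set B := s + v ^ (-(1 : ℝ) / 6) * y with hB
  have hA0 : 0 < A := by positivity
  have hB0 : 0 < B := by positivity
  have hva : 0 < v ^ ((5 : ℝ) / 6) := by positivity
  have hvb : 0 < v ^ (-(1 : ℝ) / 6) := by positivity
  have hM : 0 < B ^ ((5 : ℝ) / 6) * A ^ ((1 : ℝ) / 6) := by positivity
  have h1 := Real.geom_mean_le_arith_mean2_weighted (w₁ := 5 / 6) (w₂ := 1 / 6)
      (p₁ := v ^ (-(1 : ℝ) / 6) * y / B) (p₂ := v ^ ((5 : ℝ) / 6) / A) (by norm_num) (by norm_num)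
      (by positivity) (by positivity) (by norm_num)
  have h2 := Real.geom_mean_le_arith_mean2_weighted (w₁ := 5 / 6) (w₂ := 1 / 6)
      (p₁ := s / B) (p₂ := s / A) (by norm_num) (by norm_num)
      (by positivity) (by positivity) (by norm_num)
  rw [Real.div_rpow (by positivity) hB0.le, Real.div_rpow (by positivity) hA0.le,
    div_mul_div_comm] at h1 h2
  have e1 : (v ^ (-(1 : ℝ) / 6) * y) ^ ((5 : ℝ) / 6) * (v ^ ((5 : ℝ) / 6)) ^ ((1 : ℝ) / 6) =
      y ^ ((5 : ℝ) / 6) := by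
    rw [Real.mul_rpow hvb.le hy, ← Real.rpow_mul hv.le, ← Real.rpow_mul hv.le, mul_right_comm,
      ← Real.rpow_add hv]
    norm_num
  have e2 : s ^ ((5 : ℝ) / 6) * s ^ ((1 : ℝ) / 6) = s := by
    rw [← Real.rpow_add hs]; norm_num
  rw [e1] at h1
  rw [e2] at h2
  have h3 : 5 / 6 * (v ^ (-(1 : ℝ) / 6) * y / B) + 1 / 6 * (v ^ ((5 : ℝ) / 6) / A) +
      (5 / 6 * (s / B) + 1 / 6 * (s / A)) = 1 := by
    have f1 : v ^ (-(1 : ℝ) / 6) * y / B + s / B = 1 := by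
      rw [← add_div, add_comm, div_self hB0.ne']
    have f2 : v ^ ((5 : ℝ) / 6) / A + s / A = 1 := by
      rw [← add_div, div_self hA0.ne']
    linarith
  have h4 : (y ^ ((5 : ℝ) / 6) + s) / (B ^ ((5 : ℝ) / 6) * A ^ ((1 : ℝ) / 6)) ≤ 1 := by
    rw [add_div]; linarith
  rw [div_le_one hM] at h4
  calc (y ^ ((5 : ℝ) / 6) + s) ^ ((6 : ℝ) / 5)
      ≤ (B ^ ((5 : ℝ) / 6) * A ^ ((1 : ℝ) / 6)) ^ ((6 : ℝ) / 5) :=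
        Real.rpow_le_rpow (by positivity) h4 (by norm_num)
    _ = A ^ ((1 : ℝ) / 5) * B := by
        rw [Real.mul_rpow (by positivity) (by positivity), ← Real.rpow_mul hB0.le,
          ← Real.rpow_mul hA0.le]
        norm_num
        ring

/-- The function of time and space that turns a Lyapunov function `V` into a supermartingale. -/
noncomputable def timeLyapunov (V : Word → ℝ) (c : ℝ) (t : ℕ) (w : Word) : ℝ :=
  (V w ^ ((5 : ℝ) / 6) + c * (5 / 6) * t) ^ ((6 : ℝ) / 5)

lemma IsLyapunov.stepMean_timeLyapunov_le {β p c : ℝ} {V : Word → ℝ} (hV : IsLyapunov β p V c)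
    (hβ0 : 0 ≤ β) (hβ1 : β ≤ 1) (hp0 : 0 ≤ p) (hp1 : p ≤ 1) (t : ℕ) {w : Word}
    (hw : IsConfig w) (hne : w ≠ []) :
    stepMean β p (timeLyapunov V c (t + 1)) w ≤ timeLyapunov V c t w := by
  obtain ⟨hV0, hc, hdrift⟩ := hV
  obtain ⟨hv, hstep⟩ := hdrift w hw hne
  have hs : 0 < c * (5 / 6) * ((t + 1 : ℕ) : ℝ) := by positivity
  set s := c * (5 / 6) * ((t + 1 : ℕ) : ℝ) with hsdef
  set v := V w
  set A := v ^ ((5 : ℝ) / 6) + s with hA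
  have hA0 : 0 < A := by positivity
  have h1 := stepMean_mono hβ0 hβ1 hp0 hp1 (g := timeLyapunov V c (t + 1))
    (h := fun x => A ^ ((1 : ℝ) / 5) * s * 1 + A ^ ((1 : ℝ) / 5) * v ^ (-(1 : ℝ) / 6) * V x)
    (fun x => (rpow_add_rpow_le hv (hV0 x) hs).trans_eq (by ring)) w
  rw [stepMean_linear, stepMean_const] at h1
  refine h1.trans ?_
  have e1 : v ^ (-(1 : ℝ) / 6) * v = v ^ ((5 : ℝ) / 6) := by
    nth_rewrite 2 [← Real.rpow_one v]
    rw [← Real.rpow_add hv]; norm_num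
  have e2 : v ^ (-(1 : ℝ) / 6) * v ^ ((1 : ℝ) / 6) = 1 := by
    rw [← Real.rpow_add hv]; norm_num
  have hsA : c * (5 / 6) ≤ A := by
    have : 0 ≤ v ^ ((5 : ℝ) / 6) := by positivity
    have : 0 ≤ c * (5 / 6) * (t : ℝ) := by positivity
    rw [hA, hsdef]; push_cast; linarith
  have hb := one_add_mul_self_le_rpow_one_add (s := -(c * (5 / 6) / A)) (p := 6 / 5)
    (by rw [neg_le_neg_iff, div_le_one hA0]; exact hsA) (by norm_num)
  have e3 : timeLyapunov V c t w = A ^ ((6 : ℝ) / 5) * (1 + -(c * (5 / 6) / A)) ^ ((6 : ℝ) / 5) := by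
    rw [← Real.mul_rpow hA0.le (by
      rw [← sub_eq_add_neg, sub_nonneg, div_le_one hA0]; exact hsA)]
    have : A * (1 + -(c * (5 / 6) / A)) = v ^ ((5 : ℝ) / 6) + c * (5 / 6) * t := by
      rw [mul_add, mul_neg, mul_div_cancel₀ _ hA0.ne', hA, hsdef]; push_cast; ring
    rw [this]; rfl
  have e4 : A ^ ((6 : ℝ) / 5) = A ^ ((1 : ℝ) / 5) * A := by
    nth_rewrite 3 [← Real.rpow_one A]
    rw [← Real.rpow_add hA0]; norm_num
  rw [e3]
  calc A ^ ((1 : ℝ) / 5) * s * 1 + A ^ ((1 : ℝ) / 5) * v ^ (-(1 : ℝ) / 6) * stepMean β p V w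
      ≤ A ^ ((1 : ℝ) / 5) * s * 1 + A ^ ((1 : ℝ) / 5) * v ^ (-(1 : ℝ) / 6) *
          (v - c * v ^ ((1 : ℝ) / 6)) := by gcongr
    _ = A ^ ((1 : ℝ) / 5) * (s + v ^ (-(1 : ℝ) / 6) * v
          - c * (v ^ (-(1 : ℝ) / 6) * v ^ ((1 : ℝ) / 6))) := by ring
    _ = A ^ ((1 : ℝ) / 5) * (A - c) := by rw [e1, e2, hA]; ring
    _ = A ^ ((6 : ℝ) / 5) * (1 + 6 / 5 * -(c * (5 / 6) / A)) := by
        rw [e4]; field_simp; ring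
    _ ≤ _ := by gcongr

lemma hasSum_P_mul (β p : ℝ) (g : Word → ℝ) (w : Word) :
    HasSum (fun w' => P β p w w' * g w') (stepMean β p g w) := by
  have hcongr : ∀ {f f' : Word → ℝ} {a : ℝ}, HasSum f a → (∀ y, f' y = f y) → HasSum f' a := by
    intro f f' a h hf
    rwa [funext hf]
  have hind : ∀ x : Word, HasSum (fun w' => (if x = w' then (1 : ℝ) else 0) * g w') (g x) := by
    intro x
    refine hcongr (hasSum_ite_eq x (g x)) fun y => ?_
    by_cases hy : y = x
    · simp [hy]
    · simp [hy, Ne.symm hy]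
  have hmove : ∀ i, HasSum
      (fun w' => moveMean β p (fun x => if x = w' then 1 else 0) w i * g w')
      (moveMean β p g w i) := by
    intro i
    refine hcongr (((((hind (strip (setPair (pad w) i false false))).mul_left (β * (1 / 2))).add
      ((hind (strip (setPair (pad w) i true true))).mul_left (β * (1 / 2)))).add
      ((hind (strip (swapPair (pad w) i))).mul_left ((1 - β) * swapProb p w i))).add
      ((hind w).mul_left ((1 - β) * (1 - swapProb p w i)))) fun y => ?_
    unfold moveMean
    ring
  refine hcongr (hasSum_sum fun i (_ : i ∈ unlikeSet w) =>
    (hmove i).mul_left ((unlike w).length : ℝ)⁻¹) fun y => ?_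
  rw [P_eq_stepMean, stepMean, Finset.sum_mul]
  exact Finset.sum_congr rfl fun i _ => by ring

lemma P_nonneg {β p : ℝ} (hβ0 : 0 ≤ β) (hβ1 : β ≤ 1) (hp0 : 0 ≤ p) (hp1 : p ≤ 1)
    (w w' : Word) : 0 ≤ P β p w w' := by
  rw [P_eq_stepMean]
  have h := stepMean_mono hβ0 hβ1 hp0 hp1 (g := fun _ => (0 : ℝ))
    (h := fun x => if x = w' then 1 else 0) (fun x => by split_ifs <;> norm_num) w
  rwa [stepMean_const] at h

lemma tsum_ofReal_P_mul {β p : ℝ} (hβ0 : 0 ≤ β) (hβ1 : β ≤ 1) (hp0 : 0 ≤ p) (hp1 : p ≤ 1)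
    {g : Word → ℝ} (hg : ∀ x, 0 ≤ g x) (w : Word) :
    ∑' w', ENNReal.ofReal (P β p w w') * ENNReal.ofReal (g w') =
      ENNReal.ofReal (stepMean β p g w) := by
  have h := hasSum_P_mul β p g w
  have hP := P_nonneg hβ0 hβ1 hp0 hp1 w
  rw [← h.tsum_eq, ENNReal.ofReal_tsum_of_nonneg (fun y => mul_nonneg (hP y) (hg y)) h.summable]
  exact tsum_congr fun y => (ENNReal.ofReal_mul (hP y)).symm

section Paths

variable {Ω : Type*} {ξ : ℕ → Ω → Word}

/-- The event that the chain has not been in the ground state at the times `1, …, t`. -/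
def notRelaxed (ξ : ℕ → Ω → Word) (t : ℕ) : Set Ω :=
  {ω | (fun i : Fin (t + 1) => ξ i ω) ∈
    {h : Fin (t + 1) → Word | ∀ i : Fin (t + 1), 0 < (i : ℕ) → h i ≠ []}}

lemma mem_notRelaxed {t : ℕ} {ω : Ω} :
    ω ∈ notRelaxed ξ t ↔ ∀ i, 0 < i → i ≤ t → ξ i ω ≠ [] := by
  change (∀ i : Fin (t + 1), 0 < (i : ℕ) → ξ i ω ≠ []) ↔ _
  exact ⟨fun h i hi hit => h ⟨i, Nat.lt_succ_iff.mpr hit⟩ hi,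
    fun h i hi => h i hi (Nat.lt_succ_iff.mp i.2)⟩

lemma relaxTime_le {t : ℕ} {ω : Ω} (ht : 0 < t) (h : ξ t ω = []) :
    relaxTime ξ ω ≤ t :=
  sInf_le ⟨t, ht, h, rfl⟩

open Classical in
/-- The process `timeLyapunov` evaluated along the chain and frozen at the relaxation time. -/
noncomputable def stoppedLyapunov (V : Word → ℝ) (c : ℝ) (ξ : ℕ → Ω → Word) (t : ℕ) (ω : Ω) :
    ℝ≥0∞ :=
  if ω ∈ notRelaxed ξ t then ENNReal.ofReal (timeLyapunov V c t (ξ t ω))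
  else (ENNReal.ofReal (c * (5 / 6)) * relaxTime ξ ω) ^ ((6 : ℝ) / 5)

lemma rpow_mul_le_timeLyapunov {V : Word → ℝ} {c : ℝ} (hV : ∀ w, 0 ≤ V w) (hc : 0 ≤ c) (t : ℕ)
    (w : Word) : (ENNReal.ofReal (c * (5 / 6)) * t) ^ ((6 : ℝ) / 5) ≤
      ENNReal.ofReal (timeLyapunov V c t w) := by
  have hc' : 0 ≤ c * (5 / 6) := by positivity
  have h1 : 0 ≤ V w ^ ((5 : ℝ) / 6) := Real.rpow_nonneg (hV w) _
  rw [← ENNReal.ofReal_natCast, ← ENNReal.ofReal_mul hc',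
    ENNReal.ofReal_rpow_of_nonneg (by positivity) (by norm_num)]
  refine ENNReal.ofReal_le_ofReal (Real.rpow_le_rpow (by positivity) ?_ (by norm_num))
  linarith

lemma rpow_mul_min_le_stoppedLyapunov {V : Word → ℝ} {c : ℝ} (hV : ∀ w, 0 ≤ V w) (hc : 0 ≤ c)
    (t : ℕ) (ω : Ω) :
    (ENNReal.ofReal (c * (5 / 6)) * min (relaxTime ξ ω) t) ^ ((6 : ℝ) / 5) ≤
      stoppedLyapunov V c ξ t ω := by
  unfold stoppedLyapunov
  split_ifs
  · refine le_trans ?_ (rpow_mul_le_timeLyapunov hV hc t _)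
    gcongr
    exact min_le_right _ _
  · gcongr
    exact min_le_left _ _

end Paths

section Chain

variable {β p : ℝ} {Ω : Type*} [MeasurableSpace Ω] {μ : Measure Ω} {ξ : ℕ → Ω → Word}

/-- The one-step Markov property for events depending on the chain up to time `t`. -/
lemma IsEVChain.lintegral_next (hchain : IsEVChain β p μ ξ) (hβ0 : 0 ≤ β) (hβ1 : β ≤ 1)
    (hp0 : 0 ≤ p) (hp1 : p ≤ 1) {g : Word → ℝ} (hg : ∀ x, 0 ≤ g x) (t : ℕ)
    (C : Set (Fin (t + 1) → Word)) :
    ∫⁻ ω in {ω | (fun i : Fin (t + 1) => ξ i ω) ∈ C}, ENNReal.ofReal (g (ξ (t + 1) ω)) ∂μ =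
      ∫⁻ ω in {ω | (fun i : Fin (t + 1) => ξ i ω) ∈ C},
        ENNReal.ofReal (stepMean β p g (ξ t ω)) ∂μ := by
  classical
  obtain ⟨hmeas, hmarkov⟩ := hchain
  set H : Ω → (Fin (t + 1) → Word) := fun ω i => ξ i ω with hH
  have hHm : Measurable H := measurable_pi_lambda _ fun i => hmeas i
  have hC : MeasurableSet {ω | H ω ∈ C} := hHm C.to_countable.measurableSet
  rw [← lintegral_indicator hC, ← lintegral_indicator hC]
  have hcyl : ∀ (h : Fin (t + 1) → Word) (x : Word),
      μ {ω | H ω = h ∧ ξ (t + 1) ω = x} =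
        μ {ω | H ω = h} * ENNReal.ofReal (P β p (h (Fin.last t)) x) := by
    intro h x
    have := hmarkov t (fun i => if hi : i < t + 1 then h ⟨i, hi⟩ else x)
    have e1 : {ω | ∀ i ≤ t, ξ i ω = (fun i => if hi : i < t + 1 then h ⟨i, hi⟩ else x) i} =
        {ω | H ω = h} := by
      ext ω
      simp only [Set.mem_ofPred_eq]
      constructor
      · intro hω
        funext i
        have := hω i (Nat.lt_succ_iff.mp i.2)
        simpa [i.2] using this
      · rintro hω i hi
        have hi' : i < t + 1 := Nat.lt_succ_iff.mpr hi
        simp only [hi', dif_pos, ← hω, hH]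
    have e2 : {ω | ∀ i ≤ t + 1, ξ i ω = (fun i => if hi : i < t + 1 then h ⟨i, hi⟩ else x) i} =
        {ω | H ω = h ∧ ξ (t + 1) ω = x} := by
      ext ω
      have e1' := Set.ext_iff.mp e1 ω
      simp only [Set.mem_ofPred_eq] at e1' ⊢
      rw [← e1']
      constructor
      · intro hω
        refine ⟨fun i hi => hω i (by omega), ?_⟩
        simpa using hω (t + 1) le_rfl
      · rintro ⟨h1, h2⟩ i hi
        rcases Nat.lt_or_ge i (t + 1) with hi' | hi'
        · exact h1 i (by omega)
        · obtain rfl : i = t + 1 := by omega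
          simpa using h2
    rw [e1, e2] at this
    rw [this]
    congr 3
    · simp [Fin.last]
    · simp
  have hpair : Measurable fun ω => (H ω, ξ (t + 1) ω) := hHm.prodMk (hmeas (t + 1))
  have hL : ∫⁻ ω, {ω | H ω ∈ C}.indicator (fun ω => ENNReal.ofReal (g (ξ (t + 1) ω))) ω ∂μ =
      ∑' h, ∑' x, (if h ∈ C then ENNReal.ofReal (g x) else 0) *
        (μ {ω | H ω = h} * ENNReal.ofReal (P β p (h (Fin.last t)) x)) := by
    have e1 : ∫⁻ ω, {ω | H ω ∈ C}.indicator (fun ω => ENNReal.ofReal (g (ξ (t + 1) ω))) ω ∂μ =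
        ∫⁻ y, (fun y : (Fin (t + 1) → Word) × Word =>
          if y.1 ∈ C then ENNReal.ofReal (g y.2) else 0) y
            ∂(μ.map fun ω => (H ω, ξ (t + 1) ω)) := by
      rw [lintegral_map (measurable_of_countable _) hpair]
      rfl
    rw [e1, lintegral_countable', ENNReal.tsum_prod']
    refine tsum_congr fun h => tsum_congr fun x => ?_
    rw [Measure.map_apply hpair (measurableSet_singleton _), ← hcyl]
    congr 2
    ext ω
    simp
  have hR : ∫⁻ ω, {ω | H ω ∈ C}.indicator
        (fun ω => ENNReal.ofReal (stepMean β p g (ξ t ω))) ω ∂μ =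
      ∑' h, (if h ∈ C then ENNReal.ofReal (stepMean β p g (h (Fin.last t))) else 0) *
        μ {ω | H ω = h} := by
    have e1 : ∫⁻ ω, {ω | H ω ∈ C}.indicator
          (fun ω => ENNReal.ofReal (stepMean β p g (ξ t ω))) ω ∂μ =
        ∫⁻ h, (fun h : Fin (t + 1) → Word =>
          if h ∈ C then ENNReal.ofReal (stepMean β p g (h (Fin.last t))) else 0) h
            ∂(μ.map H) := by
      rw [lintegral_map (measurable_of_countable _) hHm]
      rfl
    rw [e1, lintegral_countable']
    refine tsum_congr fun h => ?_
    rw [Measure.map_apply hHm (measurableSet_singleton _)]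
    rfl
  rw [hL, hR]
  refine tsum_congr fun h => ?_
  by_cases hh : h ∈ C
  · simp only [hh, if_true]
    rw [← tsum_ofReal_P_mul hβ0 hβ1 hp0 hp1 hg, ← ENNReal.tsum_mul_right]
    exact tsum_congr fun x => by ring
  · simp [hh]

lemma IsEVChain.ae_isConfig (hchain : IsEVChain β p μ ξ) (hβ0 : 0 ≤ β) (hβ1 : β ≤ 1)
    (hp0 : 0 ≤ p) (hp1 : p ≤ 1) (h0 : ∀ᵐ ω ∂μ, IsConfig (ξ 0 ω)) (t : ℕ) :
    ∀ᵐ ω ∂μ, IsConfig (ξ t ω) := by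
  classical
  induction t with
  | zero => exact h0
  | succ t ih =>
    set g : Word → ℝ := fun w => if IsConfig w then 0 else 1 with hg
    have h := hchain.lintegral_next hβ0 hβ1 hp0 hp1 (g := g)
      (fun x => by rw [hg]; dsimp only; split_ifs <;> norm_num) t Set.univ
    simp only [Set.mem_univ, Set.ofPred_true, Measure.restrict_univ] at h
    have h1 : ∫⁻ ω, ENNReal.ofReal (stepMean β p g (ξ t ω)) ∂μ = 0 := by
      have hm : Measurable fun ω => ENNReal.ofReal (stepMean β p g (ξ t ω)) :=
        (measurable_of_countable fun w => ENNReal.ofReal (stepMean β p g w)).comp (hchain.1 t)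
      rw [lintegral_eq_zero_iff hm]
      filter_upwards [ih] with ω hω
      have : stepMean β p g (ξ t ω) = 0 :=
        Finset.sum_eq_zero fun i _ => by simp [moveMean, hg, isConfig_strip, hω]
      simp [this]
    have hm : Measurable fun ω => ENNReal.ofReal (g (ξ (t + 1) ω)) :=
      (measurable_of_countable fun w => ENNReal.ofReal (g w)).comp (hchain.1 (t + 1))
    rw [h1, lintegral_eq_zero_iff hm] at h
    filter_upwards [h] with ω hω
    by_contra hcon
    simp [hg, hcon] at hω

lemma measurableSet_notRelaxed (hξ : ∀ t, Measurable (ξ t)) (t : ℕ) :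
    MeasurableSet (notRelaxed ξ t) := by
  have hHm : Measurable fun ω (i : Fin (t + 1)) => ξ i ω :=
    measurable_pi_lambda _ fun i => hξ i
  exact hHm (Set.to_countable _).measurableSet

lemma measurable_relaxTime (hξ : ∀ t, Measurable (ξ t)) : Measurable (relaxTime ξ) := by
  classical
  have h : relaxTime ξ = fun ω => ⨅ t : ℕ, if 0 < t ∧ ξ t ω = [] then (t : ℝ≥0∞) else ⊤ := by
    funext ω
    refine le_antisymm (le_iInf fun t => ?_) (le_sInf ?_)
    · split_ifs with ht
      · exact relaxTime_le ht.1 ht.2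
      · exact le_top
    · rintro r ⟨t, ht, h, rfl⟩
      refine (iInf_le _ t).trans_eq ?_
      rw [if_pos ⟨ht, h⟩]
  rw [h]
  refine Measurable.iInf fun t => ?_
  exact (measurable_of_countable
    (fun w : Word => if 0 < t ∧ w = [] then (t : ℝ≥0∞) else ⊤)).comp (hξ t)

lemma lintegral_stoppedLyapunov_succ_le (hchain : IsEVChain β p μ ξ) (hβ0 : 0 ≤ β) (hβ1 : β ≤ 1)
    (hp0 : 0 ≤ p) (hp1 : p ≤ 1) {V : Word → ℝ} {c : ℝ} (hV : ∀ w, 0 ≤ V w) (hc : 0 ≤ c) (t : ℕ) :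
    ∫⁻ ω, stoppedLyapunov V c ξ (t + 1) ω ∂μ ≤
      ∫⁻ ω in notRelaxed ξ t,
          ENNReal.ofReal (stepMean β p (timeLyapunov V c (t + 1)) (ξ t ω)) ∂μ +
        ∫⁻ ω in (notRelaxed ξ t)ᶜ, stoppedLyapunov V c ξ t ω ∂μ := by
  have hA := measurableSet_notRelaxed hchain.1 t
  have hnn : ∀ x, 0 ≤ timeLyapunov V c (t + 1) x := fun x =>
    Real.rpow_nonneg (add_nonneg (Real.rpow_nonneg (hV x) _) (by positivity)) _
  rw [← lintegral_add_compl _ hA]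
  refine add_le_add ?_ ?_
  · refine le_trans ?_ (hchain.lintegral_next hβ0 hβ1 hp0 hp1 hnn t _).le
    refine setLIntegral_mono_ae' hA (ae_of_all _ fun ω hω => ?_)
    unfold stoppedLyapunov
    split_ifs with h
    · exact le_rfl
    · refine le_trans ?_ (rpow_mul_le_timeLyapunov hV hc (t + 1) _)
      gcongr
      refine relaxTime_le t.succ_pos ?_
      by_contra hne
      refine h (mem_notRelaxed.mpr fun i hi hit => ?_)
      rcases Nat.lt_or_ge t i with hti | hti
      · obtain rfl : i = t + 1 := by omega
        exact hne
      · exact mem_notRelaxed.mp hω i hi hti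
  · refine setLIntegral_mono_ae' hA.compl (ae_of_all _ fun ω hω => ?_)
    have h : ω ∉ notRelaxed ξ (t + 1) := fun h =>
      hω (mem_notRelaxed.mpr fun i hi hit => mem_notRelaxed.mp h i hi (by omega))
    rw [stoppedLyapunov, stoppedLyapunov, if_neg h, if_neg hω]

theorem IsLyapunov.lintegral_relaxTime_lt_top [IsProbabilityMeasure μ] {V : Word → ℝ} {c : ℝ}
    (hV : IsLyapunov β p V c) (hβ0 : 0 ≤ β) (hβ1 : β ≤ 1) (hp0 : 0 ≤ p) (hp1 : p ≤ 1)
    (hchain : IsEVChain β p μ ξ) {S₀ : Word} (hS₀ : IsConfig S₀) (hinit : ∀ᵐ ω ∂μ, ξ 0 ω = S₀) :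
    ∫⁻ ω, relaxTime ξ ω ^ ((6 : ℝ) / 5) ∂μ < ⊤ := by
  have hV0 := hV.1
  have hc := hV.2.1
  have hconf := hchain.ae_isConfig hβ0 hβ1 hp0 hp1 (hinit.mono fun ω h => h ▸ hS₀)
  set M := ENNReal.ofReal (stepMean β p (timeLyapunov V c 1) S₀) with hM
  have hbound : ∀ t, ∫⁻ ω, stoppedLyapunov V c ξ (t + 1) ω ∂μ ≤ M := by
    intro t
    induction t with
    | zero =>
      refine (lintegral_stoppedLyapunov_succ_le hchain hβ0 hβ1 hp0 hp1 hV0 hc.le 0).trans ?_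
      have huniv : notRelaxed ξ 0 = Set.univ :=
        Set.eq_univ_of_forall fun ω => mem_notRelaxed.mpr fun i hi hi0 => by omega
      rw [huniv, Set.compl_univ, Measure.restrict_empty, lintegral_zero_measure, add_zero,
        Measure.restrict_univ]
      have : ∀ᵐ ω ∂μ, ENNReal.ofReal (stepMean β p (timeLyapunov V c (0 + 1)) (ξ 0 ω)) = M :=
        hinit.mono fun ω h => by rw [h]
      rw [lintegral_congr_ae this]
      simp
    | succ t ih =>
      refine (lintegral_stoppedLyapunov_succ_le hchain hβ0 hβ1 hp0 hp1 hV0 hc.le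
        (t + 1)).trans (le_trans (le_trans ?_ (lintegral_add_compl (stoppedLyapunov V c ξ (t + 1))
          (measurableSet_notRelaxed hchain.1 (t + 1))).le) ih)
      have hA := measurableSet_notRelaxed hchain.1 (t + 1)
      refine add_le_add (setLIntegral_mono_ae' hA ?_) le_rfl
      filter_upwards [hconf (t + 1)] with ω hω hmem
      rw [stoppedLyapunov, if_pos hmem]
      exact ENNReal.ofReal_le_ofReal (hV.stepMean_timeLyapunov_le hβ0 hβ1 hp0 hp1 (t + 1) hω
        (mem_notRelaxed.mp hmem (t + 1) t.succ_pos le_rfl))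
  set ε := ENNReal.ofReal (c * (5 / 6)) with hε
  have hε0 : ε ≠ 0 := by
    rw [hε, Ne, ENNReal.ofReal_eq_zero, not_le]; positivity
  have hmeas := measurable_relaxTime hchain.1
  have hlim : Tendsto
      (fun t : ℕ => ∫⁻ ω, (ε * min (relaxTime ξ ω) ((t + 1 : ℕ) : ℝ≥0∞)) ^ ((6 : ℝ) / 5) ∂μ) atTop
      (nhds (∫⁻ ω, (ε * relaxTime ξ ω) ^ ((6 : ℝ) / 5) ∂μ)) := by
    refine lintegral_tendsto_of_tendsto_of_monotone (fun t => ?_) (ae_of_all _ fun ω => ?_)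
      (ae_of_all _ fun ω => ?_)
    · exact ((measurable_const.mul (hmeas.min measurable_const)).pow_const _).aemeasurable
    · intro s t hst
      dsimp only
      gcongr
    · have h1 : Tendsto (fun t : ℕ => min (relaxTime ξ ω) ((t + 1 : ℕ) : ℝ≥0∞)) atTop
          (nhds (min (relaxTime ξ ω) ⊤)) :=
        tendsto_const_nhds.min (ENNReal.tendsto_nat_nhds_top.comp (tendsto_add_atTop_nat 1))
      rw [min_top_right] at h1
      exact (ENNReal.continuous_rpow_const.tendsto _).comp
        (ENNReal.Tendsto.const_mul h1 (Or.inr ENNReal.ofReal_ne_top))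
  have hle : ∫⁻ ω, (ε * relaxTime ξ ω) ^ ((6 : ℝ) / 5) ∂μ ≤ M :=
    le_of_tendsto' hlim fun t => (lintegral_mono fun ω =>
      rpow_mul_min_le_stoppedLyapunov hV0 hc.le (t + 1) ω).trans (hbound t)
  have hmul : ∀ ω, (ε * relaxTime ξ ω) ^ ((6 : ℝ) / 5) =
      ε ^ ((6 : ℝ) / 5) * relaxTime ξ ω ^ ((6 : ℝ) / 5) := fun ω =>
    ENNReal.mul_rpow_of_nonneg _ _ (by norm_num)
  simp only [hmul] at hle
  rw [lintegral_const_mul _ (hmeas.pow_const _)] at hle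
  refine ENNReal.lt_top_of_mul_ne_top_right (hle.trans_lt ENNReal.ofReal_lt_top).ne ?_
  exact (ENNReal.rpow_pos (pos_iff_ne_zero.mpr hε0) ENNReal.ofReal_ne_top).ne'

end Chain

/-- Theorem 6: for `β ∈ [0,1]` and `p > 1/2`, the relaxation time satisfies
`E_{β,p}[τ^{6/5} | ξ₀ = S₀] < ∞` for every `S₀ ∈ 𝒟`. -/
theorem relaxTime_six_fifths_moment_finite
    (β : ℝ) (hβ0 : 0 ≤ β) (hβ1 : β ≤ 1)
    (p : ℝ) (hp : 1 / 2 < p) (hp1 : p ≤ 1)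
    (S₀ : Word) (hS₀ : IsConfig S₀)
    {Ω : Type*} [MeasurableSpace Ω] (μ : Measure Ω) [IsProbabilityMeasure μ]
    (ξ : ℕ → Ω → Word) (hchain : IsEVChain β p μ ξ)
    (hinit : ∀ᵐ ω ∂μ, ξ 0 ω = S₀) :
    ∫⁻ ω, relaxTime ξ ω ^ ((6 : ℝ) / 5) ∂μ < ⊤ := by
  have hp0 : 0 ≤ p := by linarith
  obtain ⟨V, c, hV⟩ : ∃ V c, IsLyapunov β p V c := by
    rcases hβ1.lt_or_eq with h | rfl
    · exact exists_isLyapunov_of_lt_one hβ0 h hp hp1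
    · exact exists_isLyapunov_voter hp0 hp1
  exact hV.lintegral_relaxTime_lt_top hβ0 hβ1 hp0 hp1 hchain hS₀ hinit

end EV
end

section
/- Suppose β ∈ [0,1] and p ∈ [0,1], and fix any initial configuration ξ₀ = S₀ ∈ 𝒟. Then for every ε > 0, Pr_{β,p}-almost surely, for all but finitely many t ∈ ℤ⁺: if p < 1/2 then max_{0 ≤ s ≤ t} N(ξ_s) ≤ t^{1/2}(log t)^{(1/2)+ε}, while if p ≥ 1/2 then max_{0 ≤ s ≤ t} N(ξ_s) ≤ t^{1/3}(log t)^{(1/3)+ε}. -/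
open MeasureTheory Filter
open scoped ENNReal NNReal

namespace EV

/-- The number of pairs consisting of a `0` and a `1` to its right. -/
def inversions : Word → ℝ
  | [] => 0
  | true :: w => inversions w
  | false :: w => inversions w + w.count true

/-- Half the sum of the squared numbers of `0`s to the left of each `1` and of the squared numbers
of `1`s to the right of each `0`. -/
noncomputable def quadInversions : Word → ℝ
  | [] => 0
  | true :: w => quadInversions w
  | false :: w =>
      quadInversions w + inversions w + ((w.count true : ℝ) + (w.count true : ℝ) ^ 2) / 2

lemma inversions_nonneg (w : Word) : 0 ≤ inversions w := by
  induction w with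
  | nil => simp [inversions]
  | cons a w ih => cases a <;> simp only [inversions] <;> positivity

lemma quadInversions_nonneg (w : Word) : 0 ≤ quadInversions w := by
  induction w with
  | nil => simp [quadInversions]
  | cons a w ih =>
    have := inversions_nonneg w
    cases a <;> simp only [quadInversions] <;> positivity

lemma inversions_append (u v : Word) :
    inversions (u ++ v) = inversions u + inversions v + u.count false * v.count true := by
  induction u with
  | nil => simp [inversions]
  | cons a u ih =>
    cases a <;> simp [inversions, ih]
    ring

lemma quadInversions_append (u v : Word) :
    quadInversions (u ++ v) = quadInversions u + quadInversions v
      + ((v.count true : ℝ) * (u.count false : ℝ) ^ 2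
        + (u.count false : ℝ) * (v.count true : ℝ) ^ 2) / 2
      + u.count false * inversions v + v.count true * inversions u := by
  induction u with
  | nil => simp [quadInversions, inversions]
  | cons a u ih =>
    cases a <;> simp [quadInversions, inversions, inversions_append, ih]
    ring

section Boundary

variable {α : Type*} {f : Word → α}

lemma apply_strip (hl : ∀ w, f (true :: w) = f w) (hr : ∀ w, f (w ++ [false]) = f w) (w : Word) :
    f (strip w) = f w := by
  have h1 (w : Word) : f (w.dropWhile (· = true)) = f w := by
    induction w with
    | nil => rfl
    | cons a w ih =>
      cases a
      · simp
      · simpa [hl] using ih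
  have h2 (w : Word) : f (w.reverse.dropWhile (· = false)).reverse = f w := by
    induction w using List.reverseRecOn with
    | nil => rfl
    | append_singleton w a ih =>
      cases a
      · simpa [hr] using ih
      · simp
  rw [strip, h2, h1]

lemma apply_pad (hl : ∀ w, f (true :: w) = f w) (hr : ∀ w, f (w ++ [false]) = f w) (w : Word) :
    f (pad w) = f w := by
  rw [pad, hl, hr]

end Boundary

lemma inversions_append_false (w : Word) : inversions (w ++ [false]) = inversions w := by
  simp [inversions_append, inversions]

lemma quadInversions_append_false (w : Word) :
    quadInversions (w ++ [false]) = quadInversions w := by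
  simp [quadInversions_append, quadInversions, inversions]

lemma length_pad (w : Word) : (pad w).length = w.length + 2 := by
  simp [pad]

lemma exists_pad_eq_of_mem_unlike {w : Word} {i : ℕ} (hi : i ∈ unlike w) :
    ∃ u v a, u.length = i ∧ pad w = u ++ a :: (!a) :: v := by
  simp only [unlike, List.mem_filter, List.mem_range, decide_eq_true_eq] at hi
  obtain ⟨hlt, hne⟩ := hi
  have h1 : i < (pad w).length := by rw [length_pad]; omega
  have h2 : i + 1 < (pad w).length := by rw [length_pad]; omega
  rw [List.getD_eq_getElem _ _ h1, List.getD_eq_getElem _ _ h2] at hne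
  refine ⟨(pad w).take i, (pad w).drop (i + 2), (pad w)[i], by simp; omega, ?_⟩
  have h3 : (!(pad w)[i]) = (pad w)[i + 1] := by
    revert hne; cases (pad w)[i] <;> cases (pad w)[i + 1] <;> simp
  rw [h3]
  conv_lhs => rw [← List.take_append_drop i (pad w), List.drop_eq_getElem_cons h1,
    List.drop_eq_getElem_cons h2]

lemma setPair_append (u v : Word) (a b c d : Bool) :
    setPair (u ++ a :: b :: v) u.length c d = u ++ c :: d :: v := by
  simp [setPair]

lemma swapPair_append (u v : Word) (a b : Bool) :
    swapPair (u ++ a :: b :: v) u.length = u ++ b :: a :: v := by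
  simp [swapPair, setPair_append]

/-- The expected value of `h` after a move at the pair starting at position `i` of `pad w`. -/
noncomputable def pairMean (β p : ℝ) (h : Word → ℝ) (w : Word) (i : ℕ) : ℝ :=
  let swapProb := if (pad w).getD i true then 1 - p else p
  β * (1 / 2) * h (strip (setPair (pad w) i false false))
    + β * (1 / 2) * h (strip (setPair (pad w) i true true))
    + (1 - β) * swapProb * h (strip (swapPair (pad w) i))
    + (1 - β) * (1 - swapProb) * h w

lemma hasSum_list_map_sum {ι α : Type*} (l : List ι) {F : ι → α → ℝ} {a : ι → ℝ}
    (hF : ∀ i, HasSum (F i) (a i)) :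
    HasSum (fun x => (l.map (F · x)).sum) (l.map a).sum := by
  induction l with
  | nil => simp
  | cons i l ih => simpa using (hF i).add ih

lemma hasSum_P_mul_s6 (β p : ℝ) (w : Word) (h : Word → ℝ) :
    HasSum (fun w' => P β p w w' * h w')
      ((unlike w).map fun i => ((unlike w).length : ℝ)⁻¹ * pairMean β p h w i).sum := by
  have hpt (c : Word) : HasSum (fun w' => (if c = w' then (1 : ℝ) else 0) * h w') (h c) := by
    convert hasSum_single c (f := fun w' => (if c = w' then (1 : ℝ) else 0) * h w') ?_ using 1
    · simp
    · intro w' hw'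
      simp [Ne.symm hw']
  simp only [P, ← List.sum_map_mul_right]
  refine hasSum_list_map_sum _ fun i => ?_
  simp only [pairMean, mul_assoc _ _ (h _), add_mul]
  simp only [← mul_assoc]
  simp only [mul_assoc _ (ite _ (1 : ℝ) 0) (h _)]
  have := (((((hpt (strip (setPair (pad w) i false false))).mul_left (β * (1 / 2))).add
    ((hpt (strip (setPair (pad w) i true true))).mul_left (β * (1 / 2)))).add
    ((hpt (strip (swapPair (pad w) i))).mul_left
      ((1 - β) * (if (pad w).getD i true then 1 - p else p)))).add
    ((hpt w).mul_left ((1 - β) * (1 - if (pad w).getD i true then 1 - p else p)))).mul_left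
      ((unlike w).length : ℝ)⁻¹
  convert this using 1

lemma sum_pairMean_le {β p : ℝ} {h : Word → ℝ} {w : Word} (hw : 0 ≤ h w) (c : ℕ → ℝ)
    (hc : ((unlike w).map c).sum ≤ 0)
    (hle : ∀ i ∈ unlike w, pairMean β p h w i ≤ h w + 1 + c i) :
    ((unlike w).map fun i => ((unlike w).length : ℝ)⁻¹ * pairMean β p h w i).sum ≤ h w + 1 := by
  set L : ℝ := ((unlike w).length : ℝ) with hL
  have hL0 : 0 ≤ L⁻¹ := by positivity
  calc _ ≤ ((unlike w).map fun i => L⁻¹ * (h w + 1 + c i)).sum :=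
        List.sum_le_sum fun i hi => mul_le_mul_of_nonneg_left (hle i hi) hL0
    _ = L⁻¹ * (L * (h w + 1)) + L⁻¹ * ((unlike w).map c).sum := by
        rw [List.sum_map_mul_left, List.sum_map_add, List.map_const', List.sum_replicate,
          nsmul_eq_mul, mul_add]
    _ ≤ (L⁻¹ * L) * (h w + 1) + 0 := by
        rw [mul_assoc]
        exact add_le_add le_rfl (mul_nonpos_of_nonneg_of_nonpos hL0 hc)
    _ ≤ h w + 1 := by
        rw [add_zero]
        exact mul_le_of_le_one_left (by positivity) (inv_mul_le_one)

lemma tsum_ofReal_le_of_hasSum {α : Type*} {f g : α → ℝ} {a : ℝ} (hf : ∀ x, 0 ≤ f x)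
    (hg : ∀ x, 0 ≤ g x) (h : HasSum (fun x => f x * g x) a) :
    ∑' x, ENNReal.ofReal (g x) * ENNReal.ofReal (f x) = ENNReal.ofReal a := by
  rw [← h.tsum_eq, ENNReal.ofReal_tsum_of_nonneg (fun x => mul_nonneg (hf x) (hg x)) h.summable]
  exact tsum_congr fun x => by rw [ENNReal.ofReal_mul (hf x), mul_comm]

lemma pairMean_eq {β p : ℝ} {h : Word → ℝ} (hl : ∀ w, h (true :: w) = h w)
    (hr : ∀ w, h (w ++ [false]) = h w) {w u v : Word} {a : Bool}
    (hw : pad w = u ++ a :: (!a) :: v) :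
    pairMean β p h w u.length =
      β * (1 / 2) * (h (u ++ false :: false :: v) + h (u ++ true :: true :: v))
      + (1 - β) * ((if a then 1 - p else p) * h (u ++ (!a) :: a :: v)
        + (1 - if a then 1 - p else p) * h (u ++ a :: (!a) :: v)) := by
  have : h w = h (u ++ a :: (!a) :: v) := by rw [← hw, apply_pad hl hr]
  simp only [pairMean, this, apply_strip hl hr, hw, setPair_append, swapPair_append]
  cases a <;> simp <;> ring

lemma pairMean_inversions_le {β p : ℝ} (hβ0 : 0 ≤ β) (hβ1 : β ≤ 1) (hp0 : 0 ≤ p)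
    {w : Word} {i : ℕ} (hi : i ∈ unlike w) :
    pairMean β p inversions w i ≤ inversions w + 1 := by
  obtain ⟨u, v, a, rfl, hw⟩ := exists_pad_eq_of_mem_unlike hi
  have h0 : inversions w = inversions (u ++ a :: (!a) :: v) := by
    rw [← hw, apply_pad (fun _ => rfl) inversions_append_false]
  rw [pairMean_eq (fun _ => rfl) inversions_append_false hw, h0]
  cases a <;> simp [inversions_append, inversions] <;>
    nlinarith [mul_nonneg (sub_nonneg.2 hβ1) hp0]

/-- The signed weight of the pair starting at position `i` of `l`: the number of `0`s up to `i`
plus the number of `1`s after `i`, counted positively for `10` and negatively for `01`. -/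
noncomputable def cornerWeight (l : Word) (i : ℕ) : ℝ :=
  (((l.getD i true).toNat : ℝ) - ((l.getD (i + 1) true).toNat : ℝ))
    * ((l.take (i + 1)).count false + (l.drop (i + 1)).count true)

lemma sum_cornerWeight_range (l : Word) (m : ℕ) (hm : m < l.length) :
    ∑ i ∈ Finset.range m, cornerWeight l i =
      (((l.getD 0 true).toNat : ℝ) - 1) * (l.drop 1).count true
      + (1 - ((l.getD m true).toNat : ℝ)) * (l.drop (m + 1)).count true
      - ((l.getD m true).toNat : ℝ) * (l.take m).count false := by
  induction m with
  | zero => simp; ring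
  | succ m ih =>
    have hm' : m < l.length := by omega
    rw [Finset.sum_range_succ, ih hm', cornerWeight, List.take_add_one,
      List.drop_eq_getElem_cons (i := m + 1) hm, List.getD_eq_getElem _ _ hm,
      List.getD_eq_getElem _ _ hm', List.getElem?_eq_getElem hm']
    generalize l[m] = a
    generalize l[m + 1] = b
    cases a <;> cases b <;> simp <;> ring

lemma pairMean_quadInversions_le {β p : ℝ} (hβ0 : 0 ≤ β) (hβ1 : β ≤ 1) (hp : 1 / 2 ≤ p)
    (hp1 : p ≤ 1) {w : Word} {i : ℕ} (hi : i ∈ unlike w) :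
    pairMean β p quadInversions w i ≤ quadInversions w + 1 + cornerWeight (pad w) i / 2 := by
  obtain ⟨u, v, a, rfl, hw⟩ := exists_pad_eq_of_mem_unlike hi
  have h0 : quadInversions w = quadInversions (u ++ a :: (!a) :: v) := by
    rw [← hw, apply_pad (fun _ => rfl) quadInversions_append_false]
  rw [pairMean_eq (fun _ => rfl) quadInversions_append_false hw, h0, hw, cornerWeight]
  have h1 : (0 : ℝ) ≤ u.count false + v.count true := by positivity
  have hβ := sub_nonneg.2 hβ1
  have hp' : 0 ≤ p - 1 / 2 := by linarith
  have h2 := mul_nonneg hβ hp'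
  have h3 := mul_nonneg h2 h1
  have h4 := mul_nonneg hβ (sub_nonneg.2 hp1)
  cases a <;>
    simp [quadInversions_append, quadInversions, inversions,
      List.take_append, List.drop_append, List.take_of_length_le, List.drop_of_length_le] <;>
    nlinarith

lemma sum_cornerWeight_unlike (w : Word) :
    ((unlike w).map fun i => cornerWeight (pad w) i / 2).sum = 0 := by
  have hfilter (l : List ℕ) : ((l.filter fun i =>
      (pad w).getD i true ≠ (pad w).getD (i + 1) true).map fun i => cornerWeight (pad w) i / 2).sum
      = (l.map fun i => cornerWeight (pad w) i / 2).sum := by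
    induction l with
    | nil => rfl
    | cons i l ih =>
      by_cases h : (pad w).getD i true = (pad w).getD (i + 1) true
      · have h0 : cornerWeight (pad w) i = 0 := by rw [cornerWeight, h]; ring
        rw [List.filter_cons_of_neg (by simpa using h), ih, List.map_cons, List.sum_cons, h0]
        ring
      · rw [List.filter_cons_of_pos (by simpa using h), List.map_cons, List.sum_cons, ih,
          List.map_cons, List.sum_cons]
  have hlast : (pad w).getD (w.length + 1) true = false := by simp [pad]
  have hsum := sum_cornerWeight_range (pad w) (w.length + 1) (by simp [pad])
  rw [unlike, hfilter, ← List.sum_toFinset _ List.nodup_range, List.toFinset_range,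
    ← Finset.sum_div, hsum, hlast]
  simp [pad]

lemma tsum_inversions_le {β p : ℝ} (hβ0 : 0 ≤ β) (hβ1 : β ≤ 1) (hp0 : 0 ≤ p) (hp1 : p ≤ 1)
    (w : Word) :
    ∑' w', ENNReal.ofReal (inversions w') * ENNReal.ofReal (P β p w w')
      ≤ ENNReal.ofReal (inversions w + 1) := by
  rw [tsum_ofReal_le_of_hasSum (P_nonneg hβ0 hβ1 hp0 hp1 w) inversions_nonneg
    (hasSum_P_mul_s6 β p w inversions)]
  refine ENNReal.ofReal_le_ofReal (sum_pairMean_le (inversions_nonneg w) (fun _ => 0) (by simp) ?_)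
  intro i hi
  simpa using pairMean_inversions_le hβ0 hβ1 hp0 hi

lemma tsum_quadInversions_le {β p : ℝ} (hβ0 : 0 ≤ β) (hβ1 : β ≤ 1) (hp : 1 / 2 ≤ p) (hp1 : p ≤ 1)
    (w : Word) :
    ∑' w', ENNReal.ofReal (quadInversions w') * ENNReal.ofReal (P β p w w')
      ≤ ENNReal.ofReal (quadInversions w + 1) := by
  rw [tsum_ofReal_le_of_hasSum (P_nonneg hβ0 hβ1 (by linarith) hp1 w) quadInversions_nonneg
    (hasSum_P_mul_s6 β p w quadInversions)]
  exact ENNReal.ofReal_le_ofReal (sum_pairMean_le (quadInversions_nonneg w) _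
    (sum_cornerWeight_unlike w).le fun i hi => pairMean_quadInversions_le hβ0 hβ1 hp hp1 hi)

lemma nb_false_cons (w : Word) : nb (false :: w) = nb w := by
  rw [nb, nb]
  conv_rhs => rw [← Finset.card_map (addRightEmbedding 1)]
  congr 1
  ext b
  rcases b with _ | _ | b <;> simp

lemma nb_true_cons_le (w : Word) : nb (true :: w) ≤ nb w + 1 := by
  rw [nb, nb]
  conv_rhs => rw [← Finset.card_map (addRightEmbedding 1)]
  refine (Finset.card_le_card (t := insert 0 _) ?_).trans (Finset.card_insert_le _ _)
  intro b
  rcases b with _ | _ | b <;> simp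

lemma nb_true_cons_true_cons_le (w : Word) : nb (true :: true :: w) ≤ nb (true :: w) := by
  rw [nb, nb]
  refine Finset.card_le_card_of_injOn (· - 1) ?_ ?_
  · intro b
    rcases b with _ | _ | b <;> simp
  · intro b hb c hc
    rcases b with _ | _ | b <;> rcases c with _ | _ | c <;> simp_all

lemma nb_le_count_true (w : Word) : nb w ≤ w.count true := by
  induction w with
  | nil => simp [nb]
  | cons a w ih =>
    cases a
    · simpa [nb_false_cons] using ih
    · simpa using (nb_true_cons_le w).trans (Nat.succ_le_succ ih)

lemma le_of_nb_step {φ : ℕ → ℝ} {h : Word → ℝ} (hφ : Monotone φ) (hφ1 : φ 1 ≤ 0)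
    (h0 : ∀ w, 0 ≤ h w) (hl : ∀ w, h (true :: w) = h w) (hf : ∀ w, h w ≤ h (false :: w))
    (hstep : ∀ w, φ (nb w) ≤ h w → φ (nb w + 1) ≤ h (false :: w)) : ∀ w, φ (nb w) ≤ h w
  | [] => ((hφ zero_le_one).trans hφ1).trans (h0 _)
  | false :: w => by
    rw [nb_false_cons]
    exact (le_of_nb_step hφ hφ1 h0 hl hf hstep w).trans (hf w)
  | [true] => by
    have h1 : nb [true] = 1 := by decide
    exact h1 ▸ hφ1.trans (h0 _)
  | true :: true :: w => by
    rw [hl]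
    exact (hφ (nb_true_cons_true_cons_le w)).trans
      (le_of_nb_step hφ hφ1 h0 hl hf hstep (true :: w))
  | true :: false :: w => by
    rw [hl]
    have h1 := nb_true_cons_le (false :: w)
    rw [nb_false_cons] at h1
    exact (hφ h1).trans (hstep w (le_of_nb_step hφ hφ1 h0 hl hf hstep w))

lemma monotone_sum_range_of_nonneg {a : ℕ → ℝ} (ha : ∀ i, 0 ≤ a i) :
    Monotone fun n => ∑ i ∈ Finset.range n, a i :=
  monotone_nat_of_le_succ fun n => by rw [Finset.sum_range_succ]; linarith [ha n]

lemma sum_range_cast (n : ℕ) : ∑ i ∈ Finset.range n, (i : ℝ) = (n : ℝ) * (n - 1) / 2 := by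
  induction n with
  | zero => simp
  | succ n ih => rw [Finset.sum_range_succ, ih]; push_cast; ring

lemma sum_range_cast_sq (n : ℕ) :
    ∑ i ∈ Finset.range n, (i : ℝ) ^ 2 = ((n : ℝ) - 1) * n * (2 * n - 1) / 6 := by
  induction n with
  | zero => simp
  | succ n ih => rw [Finset.sum_range_succ, ih]; push_cast; ring

lemma nb_mul_le_inversions (w : Word) : (nb w : ℝ) * (nb w - 1) / 2 ≤ inversions w := by
  rw [← sum_range_cast]
  refine le_of_nb_step (φ := fun n => ∑ i ∈ Finset.range n, (i : ℝ))
    (monotone_sum_range_of_nonneg fun i => i.cast_nonneg) (by simp) inversions_nonneg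
    (fun _ => rfl) (fun w => ?_) (fun w hw => ?_) w
  · simp [inversions]
  · have h1 : (nb w : ℝ) ≤ w.count true := by exact_mod_cast nb_le_count_true w
    rw [Finset.sum_range_succ, inversions]
    linarith

lemma nb_sq_le (w : Word) : (nb w : ℝ) ^ 2 ≤ 8 * (inversions w + 1) := by
  nlinarith [nb_mul_le_inversions w, sq_nonneg ((nb w : ℝ) - 1)]

lemma nb_cube_le (w : Word) : (nb w : ℝ) ^ 3 ≤ 8 * (quadInversions w + 1) := by
  have h : ∑ i ∈ Finset.range (nb w), (i : ℝ) ^ 2 ≤ quadInversions w := by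
    refine le_of_nb_step (φ := fun n => ∑ i ∈ Finset.range n, (i : ℝ) ^ 2)
      (monotone_sum_range_of_nonneg fun i => sq_nonneg _) (by simp) quadInversions_nonneg
      (fun _ => rfl) (fun w => ?_) (fun w hw => ?_) w
    · have := inversions_nonneg w
      rw [quadInversions, add_assoc]
      exact le_add_of_nonneg_right (by positivity)
    · have h1 : (nb w : ℝ) ≤ w.count true := by exact_mod_cast nb_le_count_true w
      have h2 := nb_mul_le_inversions w
      rw [Finset.sum_range_succ, quadInversions]
      nlinarith [(nb w).cast_nonneg (α := ℝ)]
  rw [sum_range_cast_sq] at h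
  have h0 : (0 : ℝ) ≤ nb w := Nat.cast_nonneg _
  nlinarith [mul_nonneg h0 (sq_nonneg ((nb w : ℝ) - 1)), sq_nonneg ((nb w : ℝ) - 1)]

section Chain

variable {β p : ℝ} {Ω : Type*} [MeasurableSpace Ω] {μ : Measure Ω} {ξ : ℕ → Ω → Word}

instance : MeasurableSingletonClass Word := ⟨fun _ => trivial⟩

/-- The drift of `g` along the chain is at most one on each cylinder set. -/
lemma setLIntegral_cylinder_succ_le (hchain : IsEVChain β p μ ξ) {g : Word → ℝ≥0∞}
    (hg : ∀ w, ∑' w', g w' * ENNReal.ofReal (P β p w w') ≤ g w + 1) (t : ℕ) (path : ℕ → Word) :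
    ∫⁻ ω in {ω | ∀ i ≤ t, ξ i ω = path i}, g (ξ (t + 1) ω) ∂μ
      ≤ ∫⁻ ω in {ω | ∀ i ≤ t, ξ i ω = path i}, (g (ξ t ω) + 1) ∂μ := by
  set C : Set Ω := {ω | ∀ i ≤ t, ξ i ω = path i} with hC
  have hCm : MeasurableSet C := by
    rw [hC, Set.ofPred_forall]
    refine MeasurableSet.iInter fun i => ?_
    rw [Set.ofPred_forall]
    exact MeasurableSet.iInter fun _ => hchain.1 i (measurableSet_singleton _)
  have hprob (w : Word) : μ.restrict C (ξ (t + 1) ⁻¹' {w})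
      = μ C * ENNReal.ofReal (P β p (path t) w) := by
    rw [Measure.restrict_apply (hchain.1 _ (measurableSet_singleton w))]
    have h := hchain.2 t (Function.update path (t + 1) w)
    have h1 : {ω | ∀ i ≤ t, ξ i ω = Function.update path (t + 1) w i} = C := by
      ext ω
      refine forall₂_congr fun i hi => ?_
      rw [Function.update_of_ne (by omega)]
    have h2 : {ω | ∀ i ≤ t + 1, ξ i ω = Function.update path (t + 1) w i}
        = ξ (t + 1) ⁻¹' {w} ∩ C := by
      ext ω
      rw [← h1]
      simp only [Set.mem_ofPred_eq, Set.mem_inter_iff, Set.mem_preimage, Set.mem_singleton_iff,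
        Nat.le_succ_iff, or_imp, forall_and, forall_eq, Function.update_self]
      exact and_comm
    rw [h1, h2, Function.update_self, Function.update_of_ne (by omega)] at h
    exact h
  calc ∫⁻ ω in C, g (ξ (t + 1) ω) ∂μ
      = ∑' w, g w * (μ.restrict C).map (ξ (t + 1)) {w} := by
        rw [← lintegral_countable', lintegral_map (measurable_of_countable g) (hchain.1 _)]
    _ = μ C * ∑' w, g w * ENNReal.ofReal (P β p (path t) w) := by
        rw [← ENNReal.tsum_mul_left]
        refine tsum_congr fun w => ?_
        rw [Measure.map_apply (hchain.1 _) (measurableSet_singleton w), hprob]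
        ring
    _ ≤ (g (path t) + 1) * μ C := by
        rw [mul_comm]
        exact mul_le_mul_left (hg _) _
    _ = ∫⁻ ω in C, (g (ξ t ω) + 1) ∂μ := by
        rw [← setLIntegral_const]
        refine setLIntegral_congr_fun hCm fun ω hω => ?_
        rw [hω t le_rfl]

lemma setLIntegral_succ_le (hchain : IsEVChain β p μ ξ) {g : Word → ℝ≥0∞}
    (hg : ∀ w, ∑' w', g w' * ENNReal.ofReal (P β p w w') ≤ g w + 1) (t : ℕ) (q : Word → Prop) :
    ∫⁻ ω in {ω | ∀ s ≤ t, q (ξ s ω)}, g (ξ (t + 1) ω) ∂μ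
      ≤ ∫⁻ ω in {ω | ∀ s ≤ t, q (ξ s ω)}, (g (ξ t ω) + 1) ∂μ := by
  let path (l : Fin (t + 1) → Word) (i : ℕ) : Word := if h : i < t + 1 then l ⟨i, h⟩ else []
  let C (l : {l : Fin (t + 1) → Word // ∀ i, q (l i)}) : Set Ω := {ω | ∀ i ≤ t, ξ i ω = path l i}
  have hmem {l ω} : ω ∈ C l ↔ ∀ i : Fin (t + 1), ξ i ω = l.1 i := by
    refine ⟨fun h i => ?_, fun h i hi => ?_⟩
    · have := h i (Nat.lt_succ_iff.1 i.2)
      simpa only [path, i.2, dif_pos] using this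
    · have := h ⟨i, Nat.lt_succ_iff.2 hi⟩
      simpa only [path, Nat.lt_succ_iff.2 hi, dif_pos] using this
  have hU : {ω | ∀ s ≤ t, q (ξ s ω)} = ⋃ l, C l := by
    ext ω
    simp only [Set.mem_ofPred_eq, Set.mem_iUnion, hmem]
    refine ⟨fun h => ⟨⟨fun i => ξ i ω, fun i => h i (Nat.lt_succ_iff.1 i.2)⟩, fun i => rfl⟩, ?_⟩
    rintro ⟨l, hl⟩ s hs
    have := l.2 ⟨s, Nat.lt_succ_iff.2 hs⟩
    rwa [← hl] at this
  have hCm (l) : MeasurableSet (C l) := by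
    have : C l = ⋂ i : Fin (t + 1), ξ i ⁻¹' {l.1 i} := by
      ext ω
      simp [hmem]
    rw [this]
    exact MeasurableSet.iInter fun i => hchain.1 i (measurableSet_singleton _)
  have hdisj : Pairwise (Function.onFun Disjoint C) := by
    intro l l' hne
    refine Set.disjoint_left.2 fun ω hω hω' => hne (Subtype.ext (funext fun i => ?_))
    rw [← hmem.1 hω, hmem.1 hω']
  rw [hU, lintegral_iUnion hCm hdisj, lintegral_iUnion hCm hdisj]
  exact ENNReal.tsum_le_tsum fun l => setLIntegral_cylinder_succ_le hchain hg t (path l)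

/-- A maximal inequality for a nonnegative function whose drift is at most one. -/
lemma mul_measure_exists_le [IsProbabilityMeasure μ] (hchain : IsEVChain β p μ ξ)
    {g : Word → ℝ≥0∞} (hg : ∀ w, ∑' w', g w' * ENNReal.ofReal (P β p w w') ≤ g w + 1)
    {S₀ : Word} (hinit : ∀ᵐ ω ∂μ, ξ 0 ω = S₀) (c : ℝ≥0∞) (t : ℕ) :
    c * μ {ω | ∃ s ≤ t, c ≤ g (ξ s ω)} ≤ g S₀ + t := by
  let A (t : ℕ) : Set Ω := {ω | ∀ s ≤ t, g (ξ s ω) < c}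
  have hgm (s : ℕ) : Measurable fun ω => g (ξ s ω) := (measurable_of_countable g).comp (hchain.1 s)
  have hlt (s : ℕ) : MeasurableSet {ω | g (ξ s ω) < c} := hgm s measurableSet_Iio
  have hA (t : ℕ) : MeasurableSet (A t) := by
    simp only [A, Set.ofPred_forall]
    exact MeasurableSet.iInter fun s => MeasurableSet.iInter fun _ => hlt s
  have hcompl (t : ℕ) : {ω | ∃ s ≤ t, c ≤ g (ξ s ω)} = (A t)ᶜ := by
    ext ω
    simp [A]
  have hle (B : Set Ω) (hB : MeasurableSet B) (s : ℕ) :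
      c * μ (B \ {ω | g (ξ s ω) < c}) + ∫⁻ ω in B ∩ {ω | g (ξ s ω) < c}, g (ξ s ω) ∂μ
        ≤ ∫⁻ ω in B, g (ξ s ω) ∂μ := by
    rw [← lintegral_inter_add_sdiff _ B (hlt s), add_comm, ← setLIntegral_const]
    refine add_le_add le_rfl (setLIntegral_mono (hgm s) fun ω hω => ?_)
    simpa using hω.2
  have key (t : ℕ) : c * μ (A t)ᶜ + ∫⁻ ω in A t, g (ξ t ω) ∂μ ≤ g S₀ + t := by
    induction t with
    | zero =>
      have h := hle Set.univ MeasurableSet.univ 0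
      have h0 : ∫⁻ ω, g (ξ 0 ω) ∂μ = g S₀ := by
        rw [lintegral_congr_ae (hinit.mono fun ω hω => by rw [hω] : _ =ᵐ[μ] fun _ => g S₀)]
        simp
      have hA0 : A 0 = {ω | g (ξ 0 ω) < c} := by simp [A]
      rw [Set.univ_inter, ← Set.compl_eq_univ_sdiff, ← hA0, Measure.restrict_univ, h0] at h
      simpa using h
    | succ t ih =>
      have hAs : A (t + 1) = A t ∩ {ω | g (ξ (t + 1) ω) < c} := by
        ext ω
        simp [A, Nat.le_succ_iff, or_imp, forall_and]
      have hAc : (A (t + 1))ᶜ ⊆ (A t)ᶜ ∪ (A t \ {ω | g (ξ (t + 1) ω) < c}) := by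
        rw [hAs]
        intro ω hω
        by_cases h : ω ∈ A t
        · exact Or.inr ⟨h, fun h' => hω ⟨h, h'⟩⟩
        · exact Or.inl h
      calc c * μ (A (t + 1))ᶜ + ∫⁻ ω in A (t + 1), g (ξ (t + 1) ω) ∂μ
          ≤ c * (μ (A t)ᶜ + μ (A t \ {ω | g (ξ (t + 1) ω) < c}))
            + ∫⁻ ω in A t ∩ {ω | g (ξ (t + 1) ω) < c}, g (ξ (t + 1) ω) ∂μ := by
            rw [← hAs]
            gcongr
            exact (measure_mono hAc).trans (measure_union_le _ _)
        _ ≤ c * μ (A t)ᶜ + ∫⁻ ω in A t, g (ξ (t + 1) ω) ∂μ := by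
            rw [mul_add, add_assoc]
            exact add_le_add le_rfl (hle _ (hA t) _)
        _ ≤ c * μ (A t)ᶜ + ∫⁻ ω in A t, (g (ξ t ω) + 1) ∂μ :=
            add_le_add le_rfl (setLIntegral_succ_le hchain hg t fun w => g w < c)
        _ ≤ (c * μ (A t)ᶜ + ∫⁻ ω in A t, g (ξ t ω) ∂μ) + 1 := by
            rw [lintegral_add_left (hgm t), add_assoc, lintegral_one, Measure.restrict_apply_univ]
            gcongr
            exact prob_le_one
        _ ≤ g S₀ + (t + 1 : ℕ) := by
            push_cast
            rw [← add_assoc]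
            gcongr
  rw [hcompl]
  exact le_self_add.trans (key t)

end Chain

section Growth

variable {β p : ℝ} {Ω : Type*} [MeasurableSpace Ω] {μ : Measure Ω} [IsProbabilityMeasure μ]
  {ξ : ℕ → Ω → Word}

/-- A nonnegative function whose drift is at most one grows almost surely no faster than
`t (log t) ^ (1 + δ)`. -/
lemma ae_eventually_lt_mul_log_rpow (hchain : IsEVChain β p μ ξ) {h : Word → ℝ}
    (hh : ∀ w, 0 ≤ h w)
    (hdrift : ∀ w, ∑' w', ENNReal.ofReal (h w') * ENNReal.ofReal (P β p w w')
      ≤ ENNReal.ofReal (h w + 1))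
    {S₀ : Word} (hinit : ∀ᵐ ω ∂μ, ξ 0 ω = S₀) {δ : ℝ} (hδ : 0 < δ) {c : ℝ} (hc : 0 < c) :
    ∀ᵐ ω ∂μ, ∀ᶠ t : ℕ in atTop, ∀ s ≤ t, h (ξ s ω) < c * (t * Real.log t ^ (1 + δ)) := by
  have hlog : 0 < Real.log 2 := Real.log_pos one_lt_two
  let L (n : ℕ) : ℝ := c * (2 ^ (n + 1) * ((n + 1 : ℕ) * Real.log 2) ^ (1 + δ))
  have hL (n : ℕ) : 0 < L n := by positivity
  let E (n : ℕ) : Set Ω :=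
    {ω | ∃ s ≤ 2 ^ (n + 2), ENNReal.ofReal (L n) ≤ ENNReal.ofReal (h (ξ s ω))}
  let K : ℝ := (h S₀ + 2) / (c * Real.log 2 ^ (1 + δ))
  have hE (n : ℕ) : μ (E n) ≤ ENNReal.ofReal (K * (1 / ((n + 1 : ℕ) : ℝ) ^ (1 + δ))) := by
    have h1 := mul_measure_exists_le hchain (g := fun w => ENNReal.ofReal (h w))
      (fun w => by
        simpa [ENNReal.ofReal_add (hh w) zero_le_one] using hdrift w) hinit
      (ENNReal.ofReal (L n)) (2 ^ (n + 2))
    have h2 : μ (E n) ≤ (ENNReal.ofReal (h S₀) + (2 ^ (n + 2) : ℕ)) / ENNReal.ofReal (L n) := by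
      rw [ENNReal.le_div_iff_mul_le (Or.inl (by simpa using hL n)) (Or.inl ENNReal.ofReal_ne_top),
        mul_comm]
      exact h1
    refine h2.trans ?_
    rw [← ENNReal.ofReal_natCast, ← ENNReal.ofReal_add (hh _) (Nat.cast_nonneg _),
      ← ENNReal.ofReal_div_of_pos (hL n)]
    refine ENNReal.ofReal_le_ofReal ?_
    have h3 : h S₀ + ((2 ^ (n + 2) : ℕ) : ℝ) ≤ (h S₀ + 2) * 2 ^ (n + 1) := by
      have : (1 : ℝ) ≤ 2 ^ (n + 1) := one_le_pow₀ one_le_two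
      push_cast
      nlinarith [hh S₀, pow_succ (2 : ℝ) (n + 1)]
    rw [div_le_iff₀ (hL n)]
    refine h3.trans (le_of_eq ?_)
    simp only [K, L]
    rw [Real.mul_rpow (Nat.cast_nonneg _) hlog.le]
    have h4 : 0 < Real.log 2 ^ (1 + δ) := by positivity
    have h5 : 0 < ((n + 1 : ℕ) : ℝ) ^ (1 + δ) := by positivity
    field_simp
  have hsum : ∑' n, μ (E n) ≠ ∞ := by
    refine ne_top_of_le_ne_top ?_ (ENNReal.tsum_le_tsum hE)
    exact (((summable_nat_add_iff 1).2
      (Real.summable_one_div_nat_rpow.2 (by linarith : 1 < 1 + δ))).mul_left K).tsum_ofReal_ne_top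
  filter_upwards [ae_eventually_notMem hsum] with ω hω
  obtain ⟨n₀, hn₀⟩ := eventually_atTop.1 hω
  filter_upwards [eventually_ge_atTop (2 ^ (n₀ + 1))] with t ht s hs
  have ht0 : t ≠ 0 := (lt_of_lt_of_le (by positivity) ht).ne'
  have hm : n₀ + 1 ≤ Nat.log 2 t := Nat.le_log_of_pow_le one_lt_two ht
  obtain ⟨n, hn⟩ : ∃ n, Nat.log 2 t = n + 1 := ⟨Nat.log 2 t - 1, by omega⟩
  have hlow : 2 ^ (n + 1) ≤ t := hn ▸ Nat.pow_log_le_self 2 ht0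
  have hup : t < 2 ^ (n + 2) := by
    have := Nat.lt_pow_succ_log_self one_lt_two t
    rwa [hn] at this
  have hlt : h (ξ s ω) < L n := by
    by_contra! hcon
    exact hn₀ n (by omega) ⟨s, hs.trans hup.le, ENNReal.ofReal_le_ofReal hcon⟩
  have hlowR : (2 : ℝ) ^ (n + 1) ≤ t := by exact_mod_cast hlow
  have hlogt : ((n + 1 : ℕ) : ℝ) * Real.log 2 ≤ Real.log t := by
    rw [← Real.log_pow]
    exact Real.log_le_log (by positivity) hlowR
  refine hlt.trans_le ?_
  simp only [L]
  gcongr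

/-- If `nb ^ k` is dominated by a nonnegative function whose drift is at most one, then `nb` grows
almost surely no faster than `t ^ (1 / k) (log t) ^ (1 / k + ε)`. -/
lemma ae_eventually_nb_le (hchain : IsEVChain β p μ ξ) {h : Word → ℝ} (hh : ∀ w, 0 ≤ h w)
    (hdrift : ∀ w, ∑' w', ENNReal.ofReal (h w') * ENNReal.ofReal (P β p w w')
      ≤ ENNReal.ofReal (h w + 1))
    {S₀ : Word} (hinit : ∀ᵐ ω ∂μ, ξ 0 ω = S₀) {ε : ℝ} (hε : 0 < ε) {k : ℕ} (hk : k ≠ 0)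
    (hnb : ∀ w, (nb w : ℝ) ^ k ≤ 8 * (h w + 1)) :
    ∀ᵐ ω ∂μ, ∀ᶠ t : ℕ in atTop, ∀ s ≤ t,
      (nb (ξ s ω) : ℝ) ≤ (t : ℝ) ^ (1 / (k : ℝ)) * Real.log t ^ (1 / (k : ℝ) + ε) := by
  have hk0 : (0 : ℝ) < k := by positivity
  filter_upwards [ae_eventually_lt_mul_log_rpow hchain hh hdrift hinit (mul_pos hk0 hε)
    (c := 1 / 16) (by norm_num)] with ω hω
  filter_upwards [hω, eventually_ge_atTop 16] with t ht ht16 s hs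
  have ht16' : (16 : ℝ) ≤ t := by exact_mod_cast ht16
  have hlog : 1 ≤ Real.log t := by
    rw [Real.le_log_iff_exp_le (by linarith)]
    linarith [Real.exp_one_lt_d9]
  have hlog' : 1 ≤ Real.log t ^ (1 + k * ε) := Real.one_le_rpow hlog (by positivity)
  have hpow : ((t : ℝ) ^ (1 / (k : ℝ)) * Real.log t ^ (1 / (k : ℝ) + ε)) ^ k
      = t * Real.log t ^ (1 + k * ε) := by
    rw [mul_pow, ← Real.rpow_mul_natCast (by linarith), ← Real.rpow_mul_natCast (by linarith),
      one_div_mul_cancel hk0.ne', Real.rpow_one, add_mul, one_div_mul_cancel hk0.ne', mul_comm ε]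
  rw [← pow_le_pow_iff_left₀ (Nat.cast_nonneg _) (by positivity) hk, hpow]
  nlinarith [ht s hs, hnb (ξ s ω)]

end Growth

/-- Theorem 7(i): almost-sure upper bounds on the number of blocks: a.s., for all but
finitely many `t`, `max_{0≤s≤t} N(ξ_s) ≤ t^{1/2}(log t)^{1/2+ε}` if `p < 1/2`, and
`max_{0≤s≤t} N(ξ_s) ≤ t^{1/3}(log t)^{1/3+ε}` if `p ≥ 1/2`. -/
theorem numBlocks_max_upper_bound
    (β : ℝ) (hβ0 : 0 ≤ β) (hβ1 : β ≤ 1)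
    (p : ℝ) (hp0 : 0 ≤ p) (hp1 : p ≤ 1)
    (S₀ : Word) (hS₀ : IsConfig S₀)
    {Ω : Type*} [MeasurableSpace Ω] (μ : Measure Ω) [IsProbabilityMeasure μ]
    (ξ : ℕ → Ω → Word) (hchain : IsEVChain β p μ ξ)
    (hinit : ∀ᵐ ω ∂μ, ξ 0 ω = S₀)
    (ε : ℝ) (hε : 0 < ε) :
    ∀ᵐ ω ∂μ,
      (p < 1 / 2 →
        ∀ᶠ t : ℕ in atTop, ∀ s ≤ t,
          (nb (ξ s ω) : ℝ) ≤ (t : ℝ) ^ ((1 : ℝ) / 2) * Real.log t ^ ((1 : ℝ) / 2 + ε)) ∧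
      (1 / 2 ≤ p →
        ∀ᶠ t : ℕ in atTop, ∀ s ≤ t,
          (nb (ξ s ω) : ℝ) ≤ (t : ℝ) ^ ((1 : ℝ) / 3) * Real.log t ^ ((1 : ℝ) / 3 + ε)) := by
  have hsq : ∀ᵐ ω ∂μ, ∀ᶠ t : ℕ in atTop, ∀ s ≤ t,
      (nb (ξ s ω) : ℝ) ≤ (t : ℝ) ^ ((1 : ℝ) / 2) * Real.log t ^ ((1 : ℝ) / 2 + ε) :=
    ae_eventually_nb_le hchain inversions_nonneg (tsum_inversions_le hβ0 hβ1 hp0 hp1) hinit hε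
      two_ne_zero nb_sq_le
  have hcube : 1 / 2 ≤ p → ∀ᵐ ω ∂μ, ∀ᶠ t : ℕ in atTop, ∀ s ≤ t,
      (nb (ξ s ω) : ℝ) ≤ (t : ℝ) ^ ((1 : ℝ) / 3) * Real.log t ^ ((1 : ℝ) / 3 + ε) := fun hp =>
    ae_eventually_nb_le hchain quadInversions_nonneg (tsum_quadInversions_le hβ0 hβ1 hp hp1) hinit
      hε three_ne_zero nb_cube_le
  rcases lt_or_ge p (1 / 2) with hp | hp
  · filter_upwards [hsq] with ω hω
    exact ⟨fun _ => hω, fun hp' => absurd hp hp'.not_gt⟩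
  · filter_upwards [hcube hp] with ω hω
    exact ⟨fun hp' => absurd hp hp'.not_ge, fun _ => hω⟩

end EV
end
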